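/- arXiv:2403.06169 — 2 statements merged into one kernel-verified Lean document; each statement's English description precedes it below -/
import Mathlib

section
/- Let m ≥ 1, let (R, d) be a metric space, let T_1, …, T_m ∈ [0,1), and for each j let r(T_j) = 1 + ρ(T_j) where ρ(T_j) is the unique positive root of (ρ/(1−T_j))^{1−T_j}((ρ+2)/(1+T_j))^{1+T_j} = 1. Let φ : ℝ^m × R → ℂ be continuous and T-predictable, i.e., for every pair (J⁻, J⁺) of disjoint subsets of {1,…,m} with J = J⁻ ∪ J⁺ nonempty and J' = {1,…,m} \ J, there is a map (α, x) ↦ F_{J,α,x} from ℝ^{J'} × R into the space of entire functions on ℂ^{J}, continuous for the topology of uniform convergence on compact subsets, such that whenever a ∈ ℝ^m satisfies a_j ≤ −T_j for all j ∈ J⁻ and a_j ≥ T_j for all j ∈ J⁺, one has φ(a, x) = F_{J, (a_j)_{j∈J'}, x}( (a_j)_{j∈J} ). Then for every ρ = (ρ_1, …, ρ_m) with 1 < ρ_j < r(T_j) for each j, and every k ∈ ℕ, one has φ(a, x) = lim_{min_j N_j → ∞} Σ_{ν ≺ N} Π_{j=1}^m binom(N_j, ν_j) ((1 − a_j/ρ_j^k)/2)^{ν_j}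 ((1 + a_j/ρ_j^k)/2)^{N_j−ν_j} · φ( ρ_1^k (1 − 2ν_1/N_1), …, ρ_m^k (1 − 2ν_m/N_m), x ), uniformly in (a, x) on every compact subset of (Π_j (−ρ_j^k r(T_j), ρ_j^k r(T_j))) × R. -/
section

open Finset

/-- The moment `∑ C(N,n) tⁿ (1-t)ᴺ⁻ⁿ nᵏ`. -/
noncomputable def bernsteinMoment (t : ℝ) (N k : ℕ) : ℝ :=
  ∑ n ∈ range (N + 1), (N.choose n : ℝ) * t ^ n * (1 - t) ^ (N - n) * (n : ℝ) ^ k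

theorem bernsteinMoment_zero_right (t : ℝ) (N : ℕ) : bernsteinMoment t N 0 = 1 := by
  have h := add_pow t (1 - t) N
  simp only [add_sub_cancel, one_pow] at h
  rw [h, bernsteinMoment]
  exact sum_congr rfl fun n _ => by ring

theorem bernsteinMoment_zero_left (t : ℝ) (k : ℕ) : bernsteinMoment t 0 k = 0 ^ k := by
  simp [bernsteinMoment]

theorem bernsteinMoment_succ (t : ℝ) (N k : ℕ) :
    bernsteinMoment t (N + 1) (k + 1) =
      (N + 1) * t * ∑ i ∈ range (k + 1), (k.choose i : ℝ) * bernsteinMoment t N i := by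
  have h1 : ∑ i ∈ range (k + 1), (k.choose i : ℝ) * bernsteinMoment t N i =
      ∑ n ∈ range (N + 1),
        (N.choose n : ℝ) * t ^ n * (1 - t) ^ (N - n) * ((n : ℝ) + 1) ^ k := by
    simp only [bernsteinMoment, mul_sum]
    rw [sum_comm]
    refine sum_congr rfl fun n _ => ?_
    rw [add_pow, mul_sum]
    exact sum_congr rfl fun i _ => by ring
  rw [h1, bernsteinMoment, sum_range_succ', mul_sum]
  simp only [Nat.cast_zero, ne_eq, Nat.succ_ne_zero, not_false_eq_true, zero_pow, mul_zero,
    add_zero, Nat.reduceSubDiff]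
  refine sum_congr rfl fun n _ => ?_
  have h2 : ((N + 1).choose (n + 1) : ℝ) * (n + 1) = (N + 1) * N.choose n := by
    exact_mod_cast (Nat.add_one_mul_choose_eq N n).symm
  push_cast
  linear_combination (t ^ (n + 1) * (1 - t) ^ (N - n) * ((n : ℝ) + 1) ^ k) * h2

theorem abs_bernsteinMoment_le {t τ : ℝ} (hτ : 1 ≤ τ) (ht : |t| ≤ τ) (N k : ℕ) :
    |bernsteinMoment t N k| ≤ (N * τ) ^ k := by
  induction k using Nat.strong_induction_on generalizing N with
  | _ k ih =>
    rcases k with _ | k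
    · simp [bernsteinMoment_zero_right]
    rcases N with _ | N
    · simp [bernsteinMoment_zero_left]
    have h1 : |∑ i ∈ range (k + 1), (k.choose i : ℝ) * bernsteinMoment t N i| ≤
        ((N + 1) * τ) ^ k := by
      calc |∑ i ∈ range (k + 1), (k.choose i : ℝ) * bernsteinMoment t N i|
          ≤ ∑ i ∈ range (k + 1), (k.choose i : ℝ) * (N * τ) ^ i := by
            refine (abs_sum_le_sum_abs _ _).trans (sum_le_sum fun i hi => ?_)
            rw [abs_mul, Nat.abs_cast]
            exact mul_le_mul_of_nonneg_left (ih i (by simpa using hi) N) (Nat.cast_nonneg _)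
        _ = (N * τ + 1) ^ k := by
            rw [add_pow]
            exact sum_congr rfl fun i _ => by ring
        _ ≤ ((N + 1) * τ) ^ k := by
            gcongr
            linarith
    rw [bernsteinMoment_succ, abs_mul, abs_mul, pow_succ', abs_of_nonneg (by positivity : (0:ℝ) ≤ N + 1)]
    push_cast
    gcongr

theorem abs_bernsteinMoment_sub_le {t τ : ℝ} (hτ : 1 ≤ τ) (ht : |t| ≤ τ) (N k : ℕ) :
    |bernsteinMoment t N k - (N * t) ^ k| ≤ k ^ 2 * N ^ (k - 1) * τ ^ k := by
  induction k generalizing N with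
  | zero => simp [bernsteinMoment_zero_right]
  | succ k ih =>
    rcases N with _ | N
    · simp [bernsteinMoment_zero_left]
      positivity
    have hN : (0 : ℝ) ≤ N := Nat.cast_nonneg N
    have hdiff : ((N : ℝ) + 1) ^ k - (N : ℝ) ^ k ≤ k * ((N : ℝ) + 1) ^ (k - 1) := by
      have h := (le_abs_self _).trans (abs_pow_sub_pow_le ((N : ℝ) + 1) N k)
      rw [abs_of_nonneg hN, abs_of_nonneg (by linarith : (0 : ℝ) ≤ N + 1),
        max_eq_left (by linarith)] at h
      simpa using h
    have h1 : |∑ i ∈ range k, (k.choose i : ℝ) * bernsteinMoment t N i| ≤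
        (((N : ℝ) + 1) ^ k - (N : ℝ) ^ k) * τ ^ k := by
      calc |∑ i ∈ range k, (k.choose i : ℝ) * bernsteinMoment t N i|
          ≤ ∑ i ∈ range k, (k.choose i : ℝ) * (N : ℝ) ^ i * τ ^ k := by
            refine (abs_sum_le_sum_abs _ _).trans (sum_le_sum fun i hi => ?_)
            rw [abs_mul, Nat.abs_cast, mul_assoc]
            refine mul_le_mul_of_nonneg_left ?_ (Nat.cast_nonneg _)
            refine (abs_bernsteinMoment_le hτ ht N i).trans ?_
            rw [mul_pow]
            gcongr
            exact (mem_range.1 hi).le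
        _ = (((N : ℝ) + 1) ^ k - (N : ℝ) ^ k) * τ ^ k := by
            rw [← sum_mul, add_pow, sum_range_succ]
            simp [mul_comm]
    have h2 : |((N : ℝ) * t) ^ k - ((N + 1) * t) ^ k| ≤
        (((N : ℝ) + 1) ^ k - (N : ℝ) ^ k) * τ ^ k := by
      rw [mul_pow, mul_pow, ← sub_mul, abs_mul, abs_sub_comm, abs_pow, abs_of_nonneg]
      · gcongr
        exact sub_nonneg.2 (by gcongr; linarith)
      · exact sub_nonneg.2 (by gcongr; linarith)
    have h3 : |∑ i ∈ range (k + 1), (k.choose i : ℝ) * bernsteinMoment t N i -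
        ((N + 1) * t) ^ k| ≤ (k + 1) ^ 2 * (N + 1) ^ (k - 1) * τ ^ k := by
      have hNk : (N : ℝ) ^ (k - 1) ≤ (N + 1) ^ (k - 1) := by gcongr; linarith
      have e : ∑ i ∈ range (k + 1), (k.choose i : ℝ) * bernsteinMoment t N i -
          ((N + 1) * t) ^ k = ∑ i ∈ range k, (k.choose i : ℝ) * bernsteinMoment t N i +
          (bernsteinMoment t N k - (N * t) ^ k) + ((N * t) ^ k - ((N + 1) * t) ^ k) := by
        rw [sum_range_succ]
        simp
        ring
      rw [e]
      refine (abs_add_three _ _ _).trans ?_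
      have hτk : 0 ≤ τ ^ k := by positivity
      have h5 : 0 ≤ ((N : ℝ) + 1) ^ (k - 1) := by positivity
      calc _ ≤ (k * ((N : ℝ) + 1) ^ (k - 1)) * τ ^ k + k ^ 2 * ((N : ℝ) + 1) ^ (k - 1) * τ ^ k
              + (k * ((N : ℝ) + 1) ^ (k - 1)) * τ ^ k := by
            refine add_le_add (add_le_add (h1.trans ?_) ((ih N).trans ?_)) (h2.trans ?_)
            · gcongr
            · gcongr
            · gcongr
        _ ≤ _ := by nlinarith [mul_nonneg h5 hτk]
    rw [bernsteinMoment_succ]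
    have e : ((N : ℝ) + 1) * t * ∑ i ∈ range (k + 1), (k.choose i : ℝ) * bernsteinMoment t N i -
        ((N + 1) * t) ^ (k + 1) = ((N + 1) * t) * (∑ i ∈ range (k + 1),
          (k.choose i : ℝ) * bernsteinMoment t N i - ((N + 1) * t) ^ k) := by ring
    push_cast
    rw [e, abs_mul, abs_mul, abs_of_nonneg (by positivity : (0 : ℝ) ≤ N + 1)]
    rcases k with _ | k
    · simp [bernsteinMoment_zero_right]
      positivity
    · calc _ ≤ ((N : ℝ) + 1) * τ * (((k + 1 : ℕ) + 1) ^ 2 * (N + 1) ^ (k + 1 - 1) * τ ^ (k + 1)) := by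
            gcongr
        _ = _ := by
            rw [Nat.add_sub_cancel]
            push_cast
            ring

/-- The Bernstein weight of the node `1 - 2n/N` on `[-1, 1]`. -/
noncomputable def bernsteinWeight (N n : ℕ) (a : ℝ) : ℝ :=
  N.choose n * ((1 - a) / 2) ^ n * ((1 + a) / 2) ^ (N - n)

/-- The `n`-th node of the Bernstein polynomial of degree `N` on `[-1, 1]`. -/
noncomputable def bernsteinNode (N n : ℕ) : ℝ :=
  1 - 2 * (n : ℝ) / N

/-- The `N`-th Bernstein polynomial on `[-1, 1]` of `f`, evaluated at `a`. -/
noncomputable def bernsteinSum (N : ℕ) (f : ℝ → ℂ) (a : ℝ) : ℂ :=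
  ∑ n ∈ range (N + 1), (bernsteinWeight N n a : ℂ) * f (bernsteinNode N n)

theorem sum_bernsteinWeight_mul_pow (N k : ℕ) (a : ℝ) :
    ∑ n ∈ range (N + 1), bernsteinWeight N n a * (n : ℝ) ^ k =
      bernsteinMoment ((1 - a) / 2) N k := by
  have h : 1 - (1 - a) / 2 = (1 + a) / 2 := by ring
  simp only [bernsteinMoment, bernsteinWeight, h]

theorem sum_bernsteinWeight (N : ℕ) (a : ℝ) :
    ∑ n ∈ range (N + 1), bernsteinWeight N n a = 1 := by
  simpa [bernsteinMoment_zero_right] using sum_bernsteinWeight_mul_pow N 0 a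

theorem bernsteinWeight_nonneg {a : ℝ} (ha : |a| ≤ 1) (N n : ℕ) : 0 ≤ bernsteinWeight N n a := by
  have := abs_le.1 ha
  have h1 : 0 ≤ (1 - a) / 2 := by linarith
  have h2 : 0 ≤ (1 + a) / 2 := by linarith
  unfold bernsteinWeight
  positivity

theorem abs_bernsteinNode_le {N n : ℕ} (hn : n ∈ range (N + 1)) :
    |bernsteinNode N n| ≤ 1 := by
  have h : (n : ℝ) ≤ N := by exact_mod_cast Nat.lt_succ_iff.1 (mem_range.1 hn)
  have h1 : (n : ℝ) / N ≤ 1 := div_le_one_of_le₀ h (Nat.cast_nonneg _)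
  have h2 : 0 ≤ (n : ℝ) / N := by positivity
  rw [bernsteinNode, mul_div_assoc, abs_le]
  constructor <;> linarith

theorem bernsteinSum_neg {N : ℕ} (hN : 1 ≤ N) (f : ℝ → ℂ) (a : ℝ) :
    bernsteinSum N f (-a) = bernsteinSum N (fun x => f (-x)) a := by
  unfold bernsteinSum
  rw [← sum_flip]
  refine sum_congr rfl fun n hn => ?_
  have h : n ≤ N := Nat.lt_succ_iff.1 (mem_range.1 hn)
  congr 1
  · rw [bernsteinWeight, bernsteinWeight, Nat.choose_symm h, Nat.sub_sub_self h]
    congr 1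
    ring_nf
  · congr 1
    have : (N : ℝ) ≠ 0 := by positivity
    unfold bernsteinNode
    push_cast [h]
    field_simp
    ring

/-- Chebyshev's inequality for the Bernstein weights. -/
theorem sum_bernsteinWeight_filter_le {a δ : ℝ} (ha : |a| ≤ 1) (hδ : 0 < δ) {N : ℕ}
    (hN : 1 ≤ N) :
    ∑ n ∈ range (N + 1) with δ ≤ |bernsteinNode N n - a|, bernsteinWeight N n a ≤
      16 / (N * δ ^ 2) := by
  have hN0 : (0 : ℝ) < N := by exact_mod_cast hN
  have hle := abs_le.1 ha
  set t := (1 - a) / 2 with ht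
  have ht1 : |t| ≤ 1 := by rw [abs_le]; constructor <;> rw [ht] <;> linarith
  have key : ∑ n ∈ range (N + 1), bernsteinWeight N n a * (bernsteinNode N n - a) ^ 2 =
      4 / N ^ 2 * ((bernsteinMoment t N 2 - (N * t) ^ 2) -
        2 * N * t * (bernsteinMoment t N 1 - (N * t) ^ 1)) := by
    have e : ∀ n : ℕ, bernsteinWeight N n a * (bernsteinNode N n - a) ^ 2 =
        4 / N ^ 2 * (bernsteinWeight N n a * (n : ℝ) ^ 2)
          - 8 * t / N * (bernsteinWeight N n a * (n : ℝ) ^ 1)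
          + 4 * t ^ 2 * (bernsteinWeight N n a) := by
      intro n
      have : a = 1 - 2 * t := by rw [ht]; ring
      rw [this, bernsteinNode]
      field_simp
      ring
    simp only [e, sum_add_distrib, sum_sub_distrib, ← mul_sum, sum_bernsteinWeight_mul_pow,
      sum_bernsteinWeight, ← ht]
    field_simp
    ring
  have hm1 : bernsteinMoment t N 1 - (N * t) ^ 1 = 0 := by
    obtain ⟨K, rfl⟩ : ∃ K, N = K + 1 := ⟨N - 1, by omega⟩
    rw [bernsteinMoment_succ]
    simp [bernsteinMoment_zero_right]
  have hm2 := (le_abs_self _).trans (abs_bernsteinMoment_sub_le le_rfl ht1 N 2)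
  have hvar : ∑ n ∈ range (N + 1), bernsteinWeight N n a * (bernsteinNode N n - a) ^ 2 ≤
      16 / N := by
    rw [key, hm1, mul_zero, sub_zero]
    calc _ ≤ 4 / (N : ℝ) ^ 2 * ((2 : ℕ) ^ 2 * N ^ (2 - 1) * 1 ^ 2) := by gcongr
      _ = 16 / N := by
        field_simp
        norm_num [mul_comm]
  rw [le_div_iff₀ (by positivity)]
  calc _ = N * ∑ n ∈ range (N + 1) with δ ≤ |bernsteinNode N n - a|,
        bernsteinWeight N n a * δ ^ 2 := by rw [← sum_mul]; ring
    _ ≤ N * ∑ n ∈ range (N + 1) with δ ≤ |bernsteinNode N n - a|,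
        bernsteinWeight N n a * (bernsteinNode N n - a) ^ 2 := by
      refine mul_le_mul_of_nonneg_left (sum_le_sum fun n hn => ?_) hN0.le
      refine mul_le_mul_of_nonneg_left ?_ (bernsteinWeight_nonneg ha N n)
      rw [sq_le_sq, abs_of_pos hδ]
      exact (mem_filter.1 hn).2
    _ ≤ N * ∑ n ∈ range (N + 1), bernsteinWeight N n a * (bernsteinNode N n - a) ^ 2 := by
      refine mul_le_mul_of_nonneg_left
        (sum_le_sum_of_subset_of_nonneg (filter_subset _ _) fun n _ _ => ?_) hN0.le
      exact mul_nonneg (bernsteinWeight_nonneg ha N n) (sq_nonneg _)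
    _ ≤ N * (16 / N) := by gcongr
    _ = 16 := by field_simp

theorem exists_norm_bernsteinSum_sub_le :
    ∃ C : ℝ, ∀ L : ℝ, 1 ≤ L → ∀ g : ℂ → ℂ, Differentiable ℂ g → ∀ M : ℝ,
      (∀ w, ‖w‖ ≤ 1 + 4 * L → ‖g w‖ ≤ M) → ∀ N : ℕ, 1 ≤ N → ∀ a : ℝ, |a| ≤ L →
        ‖bernsteinSum N (fun x => g x) a - g a‖ ≤ C / N * M := by
  have hs := (summable_pow_mul_geometric_of_norm_lt_one (R := ℝ) 2 (r := 1 / 2) (by norm_num)).hasSum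
  refine ⟨∑' k : ℕ, (k : ℝ) ^ 2 * (1 / 2) ^ k, fun L hL g hg M hM N hN a ha => ?_⟩
  have hN0 : (0 : ℝ) < N := by exact_mod_cast hN
  have hM0 : 0 ≤ M := (norm_nonneg _).trans (hM 0 (by simp; linarith))
  have hL0 : 0 < L := by linarith
  set G : ℂ → ℂ := fun z => g (1 - 2 * z) with hG
  have hGd : Differentiable ℂ G := hg.comp (by fun_prop)
  set c : ℕ → ℂ := fun k => ((k.factorial : ℂ))⁻¹ * iteratedDeriv k G 0 with hc
  have hcs : ∀ z, HasSum (fun k => c k * z ^ k) (G z) := fun z => by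
    have e : (fun k => c k * z ^ k) =
        fun k => ((k.factorial : ℂ))⁻¹ • (z - 0) ^ k • iteratedDeriv k G 0 := by
      funext k
      simp only [hc, smul_eq_mul, sub_zero]
      ring
    rw [e]
    exact Complex.hasSum_taylorSeries_of_entire hGd 0 z
  have hcb : ∀ k, ‖c k‖ ≤ M / (2 * L) ^ k := fun k => by
    have h := Complex.norm_iteratedDeriv_le_of_forall_mem_sphere_norm_le k
      (by positivity : 0 < 2 * L) (hGd.diffContOnCl (s := Metric.ball 0 (2 * L))) (C := M)
      fun z hz => hM _ ?_
    · rw [hc, norm_mul, norm_inv, Complex.norm_natCast, inv_mul_le_iff₀ (by positivity)]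
      simpa [mul_div_assoc] using h
    · have hz' : ‖z‖ = 2 * L := by simpa using hz
      refine (norm_sub_le _ _).trans ?_
      rw [norm_mul, hz']
      norm_num
      linarith
  set t := (1 - a) / 2 with ht
  have ht1 : |t| ≤ L := by
    have := abs_le.1 ha
    rw [abs_le]
    constructor <;> rw [ht] <;> linarith
  have hB : HasSum (fun k => c k * ((bernsteinMoment t N k / N ^ k : ℝ) : ℂ))
      (bernsteinSum N (fun x => g x) a) := by
    have h : HasSum (fun k => ∑ n ∈ range (N + 1),
        (bernsteinWeight N n a : ℂ) * (c k * ((n / N : ℝ) : ℂ) ^ k))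
        (∑ n ∈ range (N + 1), (bernsteinWeight N n a : ℂ) * G ((n / N : ℝ) : ℂ)) :=
      hasSum_sum fun n _ => (hcs _).mul_left _
    have e1 : bernsteinSum N (fun x => g x) a =
        ∑ n ∈ range (N + 1), (bernsteinWeight N n a : ℂ) * G ((n / N : ℝ) : ℂ) := by
      refine sum_congr rfl fun n _ => ?_
      simp only [hG, bernsteinNode]
      push_cast
      ring_nf
    rw [e1]
    convert h using 2 with k
    rw [ht, ← sum_bernsteinWeight_mul_pow, sum_div]
    push_cast
    rw [mul_sum]
    exact sum_congr rfl fun n _ => by rw [div_pow]; ring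
  have hA : HasSum (fun k => c k * ((t ^ k : ℝ) : ℂ)) (g a) := by
    have e : G t = g a := by simp only [hG, ht]; push_cast; ring_nf
    rw [← e]
    simpa using hcs t
  refine (hB.sub hA).norm_le_of_bounded (hs.mul_right (M / N)) (fun k => ?_) |>.trans_eq (by ring)
  rw [← mul_sub, ← Complex.ofReal_sub, norm_mul, Complex.norm_real, Real.norm_eq_abs]
  have e2 : bernsteinMoment t N k / N ^ k - t ^ k =
      (bernsteinMoment t N k - (N * t) ^ k) / N ^ k := by
    rw [mul_pow]
    field_simp
  rw [e2, abs_div, abs_of_pos (by positivity : (0 : ℝ) < N ^ k)]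
  calc _ ≤ M / (2 * L) ^ k * (k ^ 2 * N ^ (k - 1) * L ^ k / N ^ k) := by
        gcongr
        · exact hcb k
        · exact abs_bernsteinMoment_sub_le hL ht1 N k
    _ = k ^ 2 * (1 / 2) ^ k * (M / N) := by
        rcases k with _ | k
        · simp
        · rw [Nat.add_sub_cancel, mul_pow, one_div, inv_pow]
          field_simp
          ring

theorem exists_sum_abs_bernsteinWeight_le {T r r' : ℝ} (hT : T ∈ Set.Ico (0 : ℝ) 1) (hr0 : 0 < r - 1)
    (hr : ((r - 1) / (1 - T)) ^ (1 - T) * ((r - 1 + 2) / (1 + T)) ^ (1 + T) = 1)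
    (hr' : 1 ≤ r') (hlt : r' < r) :
    ∃ q : ℝ, 0 ≤ q ∧ q < 1 ∧ ∀ N : ℕ, 1 ≤ N → ∀ a, 1 ≤ a → a ≤ r' →
      ∑ n ∈ range (N + 1) with bernsteinNode N n < T, |bernsteinWeight N n a| ≤ q ^ N := by
  obtain ⟨hT0, hT1⟩ := hT
  have h1T : 0 < 1 - T := by linarith
  have hTp : 0 < 1 + T := by linarith
  have hrp : 0 < r + 1 := by linarith
  have hX : 0 < (r - 1) / (1 - T) := by positivity
  have e2 : r - 1 + 2 = r + 1 := by ring
  rw [e2] at hr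
  have hY : 1 < (r + 1) / (1 + T) := by rw [lt_div_iff₀ hTp]; linarith
  have hY0 : 0 < (r + 1) / (1 + T) := by linarith
  have hX1 : (r - 1) / (1 - T) ≤ 1 := by
    by_contra! h
    have h1 := Real.one_lt_rpow h h1T
    have h2 := Real.one_lt_rpow hY hTp
    nlinarith
  set t := ((r + 1) / (1 + T)) / ((r - 1) / (1 - T)) with ht
  have ht1 : 1 ≤ t := by
    rw [ht, le_div_iff₀ hX]
    linarith
  have ht0 : 0 < t := by linarith
  set p := (1 - T) / 2 with hp
  have hp0 : 0 < p := by positivity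
  have hval : t ^ (-p) * ((r - 1) / 2 * t + (r + 1) / 2) = 1 := by
    have h1 : (r - 1) / 2 * t + (r + 1) / 2 = (r + 1) / (1 + T) := by
      rw [ht]
      field_simp
      ring
    have h2 : t ^ (-p) = ((r - 1) / (1 - T)) ^ p * ((r + 1) / (1 + T)) ^ (-p) := by
      rw [ht, Real.div_rpow hY0.le hX.le, Real.rpow_neg hX.le, div_inv_eq_mul, mul_comm]
    have h3 : ((r + 1) / (1 + T)) ^ (-p) * ((r + 1) / (1 + T)) =
        ((r + 1) / (1 + T)) ^ ((1 + T) / 2) := by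
      nth_rw 2 [← Real.rpow_one ((r + 1) / (1 + T))]
      rw [← Real.rpow_add hY0, hp]
      ring_nf
    rw [h1, h2, mul_assoc, h3]
    have h4 : (((r - 1) / (1 - T)) ^ p * ((r + 1) / (1 + T)) ^ ((1 + T) / 2)) ^ 2 = 1 := by
      rw [mul_pow, ← Real.rpow_mul_natCast hX.le, ← Real.rpow_mul_natCast hY0.le, hp]
      simpa using hr
    exact (pow_eq_one_iff_of_nonneg (by positivity) two_ne_zero).1 h4
  refine ⟨t ^ (-p) * ((r' - 1) / 2 * t + (r' + 1) / 2), ?_, ?_, fun N hN a ha ha' => ?_⟩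
  · have : 0 ≤ r' - 1 := by linarith
    positivity
  · refine lt_of_lt_of_eq ?_ hval
    gcongr
  have hN0 : (0 : ℝ) < N := by exact_mod_cast hN
  have hu : 0 ≤ (a - 1) / 2 := by linarith
  have hv : 0 ≤ (1 + a) / 2 := by linarith
  have hw : ∀ n, |bernsteinWeight N n a| = N.choose n * ((a - 1) / 2) ^ n * ((1 + a) / 2) ^ (N - n) := by
    intro n
    rw [bernsteinWeight, abs_mul, abs_mul, Nat.abs_cast, abs_pow, abs_pow, abs_of_nonneg hv,
      ← abs_neg, abs_of_nonneg] <;> [ring_nf; linarith]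
  calc ∑ n ∈ range (N + 1) with bernsteinNode N n < T, |bernsteinWeight N n a|
      ≤ ∑ n ∈ range (N + 1) with bernsteinNode N n < T,
          (t ^ (-p)) ^ N * (((a - 1) / 2 * t) ^ n * ((1 + a) / 2) ^ (N - n) * N.choose n) := by
        refine sum_le_sum fun n hn => ?_
        have hn' := (mem_filter.1 hn).2
        have hpn : p * N ≤ n := by
          rw [bernsteinNode, sub_lt_comm, lt_div_iff₀ hN0] at hn'
          rw [hp]
          linarith
        have h1 : 1 ≤ (t ^ (-p)) ^ N * t ^ n := by
          rw [← Real.rpow_natCast, ← Real.rpow_mul ht0.le, ← Real.rpow_natCast,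
            ← Real.rpow_add ht0]
          exact Real.one_le_rpow ht1 (by linarith)
        rw [hw, mul_pow]
        calc _ ≤ (N.choose n * ((a - 1) / 2) ^ n * ((1 + a) / 2) ^ (N - n)) *
              ((t ^ (-p)) ^ N * t ^ n) := le_mul_of_one_le_right (by positivity) h1
          _ = _ := by ring
    _ ≤ ∑ n ∈ range (N + 1),
          (t ^ (-p)) ^ N * (((a - 1) / 2 * t) ^ n * ((1 + a) / 2) ^ (N - n) * N.choose n) :=
        sum_le_sum_of_subset_of_nonneg (filter_subset _ _) fun n _ _ => by positivity
    _ = (t ^ (-p) * ((a - 1) / 2 * t + (1 + a) / 2)) ^ N := by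
        rw [← mul_sum, ← add_pow, mul_pow]
    _ ≤ _ := by
        gcongr ?_ ^ N
        gcongr t ^ (-p) * ?_
        nlinarith

/-- `f 1` and `f (-1)` are entire extensions of `f 0` from `[T, ∞)` and `(-∞, -T]`, and all three
functions are bounded by `M` on the disc of radius `D`. -/
structure SheetBound (T D M : ℝ) (f : SignType → ℂ → ℂ) : Prop where
  differentiable : ∀ σ, σ ≠ 0 → Differentiable ℂ (f σ)
  eq_zero_sheet : ∀ σ : SignType, σ ≠ 0 → ∀ u : ℝ, T ≤ (σ : ℝ) * u → f σ u = f 0 u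
  norm_le : ∀ σ w, ‖w‖ ≤ D → ‖f σ w‖ ≤ M

theorem SheetBound.neg {T D M : ℝ} {f : SignType → ℂ → ℂ} (hf : SheetBound T D M f) :
    SheetBound T D M fun σ w => f (-σ) (-w) where
  differentiable σ hσ := (hf.differentiable (-σ) (by simpa using hσ)).comp differentiable_neg
  eq_zero_sheet σ hσ u hu := by
    have := hf.eq_zero_sheet (-σ) (by simpa using hσ) (-u) (by simpa using hu)
    simpa using this
  norm_le σ w hw := hf.norm_le _ _ (by simpa using hw)

theorem SheetBound.nonneg {T D M : ℝ} {f : SignType → ℂ → ℂ} (hf : SheetBound T D M f)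
    (hD : 0 ≤ D) : 0 ≤ M :=
  (norm_nonneg _).trans (hf.norm_le 0 0 (by simpa using hD))

theorem norm_sum_bernsteinWeight_mul_le {s : Finset ℕ} {N : ℕ} {a M : ℝ} {g : ℕ → ℂ}
    (hg : ∀ n ∈ s, ‖g n‖ ≤ M) :
    ‖∑ n ∈ s, (bernsteinWeight N n a : ℂ) * g n‖ ≤ (∑ n ∈ s, |bernsteinWeight N n a|) * M := by
  rw [sum_mul]
  refine (norm_sum_le _ _).trans (sum_le_sum fun n hn => ?_)
  rw [norm_mul, Complex.norm_real, Real.norm_eq_abs]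
  exact mul_le_mul_of_nonneg_left (hg n hn) (abs_nonneg _)

theorem sum_abs_bernsteinWeight {a : ℝ} (ha : |a| ≤ 1) (N : ℕ) :
    ∑ n ∈ range (N + 1), |bernsteinWeight N n a| = 1 := by
  rw [← sum_bernsteinWeight N a]
  exact sum_congr rfl fun n _ => abs_of_nonneg (bernsteinWeight_nonneg ha N n)

open Filter Topology in
/-- Outside `(-(1 + T) / 2, (1 + T) / 2)` the Bernstein sums converge at a rate which depends
on the function only through its bound. -/
theorem SheetBound.exists_rate {T r r' : ℝ} (hT : T ∈ Set.Ico (0 : ℝ) 1) (hr0 : 0 < r - 1)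
    (hr : ((r - 1) / (1 - T)) ^ (1 - T) * ((r - 1 + 2) / (1 + T)) ^ (1 + T) = 1)
    (hr' : 1 ≤ r') (hlt : r' < r) :
    ∃ e : ℕ → ℝ, Tendsto e atTop (𝓝 0) ∧ ∀ N : ℕ, 1 ≤ N → ∀ M f,
      SheetBound T (1 + 4 * r') M f → ∀ a : ℝ, (1 + T) / 2 ≤ |a| → |a| ≤ r' →
        ‖bernsteinSum N (fun x => f 0 x) a - f 0 a‖ ≤ e N * M := by
  obtain ⟨C, hC⟩ := exists_norm_bernsteinSum_sub_le
  obtain ⟨q, hq0, hq1, hq⟩ := exists_sum_abs_bernsteinWeight_le hT hr0 hr hr' hlt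
  have hδ : 0 < (1 - T) / 2 := by linarith [hT.2]
  refine ⟨fun N => C / N + (q ^ N + 16 / (N * ((1 - T) / 2) ^ 2)) * (2 * 1), ?_, ?_⟩
  · have h1 := tendsto_const_div_atTop_nhds_zero_nat C
    have h2 := tendsto_pow_atTop_nhds_zero_of_lt_one hq0 hq1
    have h3 := tendsto_const_div_atTop_nhds_zero_nat (16 / ((1 - T) / 2) ^ 2)
    have h4 := h1.add ((h2.add h3).mul_const (2 * 1))
    simp only [add_zero, zero_mul] at h4
    refine h4.congr fun N => ?_
    rw [div_div, mul_comm (((1 - T) / 2) ^ 2)]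
  have right : ∀ N : ℕ, 1 ≤ N → ∀ M f, SheetBound T (1 + 4 * r') M f → ∀ a : ℝ,
      (1 + T) / 2 ≤ a → a ≤ r' → ‖bernsteinSum N (fun x => f 0 x) a - f 0 a‖ ≤
        (C / N + (q ^ N + 16 / (N * ((1 - T) / 2) ^ 2)) * (2 * 1)) * M := by
    intro N hN M f hf a ha ha'
    have hN0 : (0 : ℝ) < N := by exact_mod_cast hN
    have hM := hf.nonneg (by linarith)
    have ha0 : 0 ≤ a := by linarith [hT.1]
    have hTa : T ≤ a := by linarith [hT.2]
    have hfa : f 0 a = f 1 a := (hf.eq_zero_sheet 1 (by decide) a (by simpa using hTa)).symm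
    have h1 := hC r' hr' (f 1) (hf.differentiable 1 (by decide)) M (hf.norm_le 1) N hN a
      (by rwa [abs_of_nonneg ha0])
    have htail : ∑ n ∈ range (N + 1) with bernsteinNode N n < T, |bernsteinWeight N n a| ≤
        q ^ N + 16 / (N * ((1 - T) / 2) ^ 2) := by
      rcases le_total 1 a with h | h
      · refine (hq N hN a h ha').trans ?_
        have : 0 ≤ 16 / (N * ((1 - T) / 2) ^ 2) := by positivity
        linarith
      · have ha1 : |a| ≤ 1 := by rwa [abs_of_nonneg ha0]
        have h2 := sum_bernsteinWeight_filter_le ha1 hδ hN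
        have h3 : 0 ≤ q ^ N := by positivity
        refine le_trans (le_trans ?_ h2) (by linarith)
        rw [sum_congr rfl fun n _ => abs_of_nonneg (bernsteinWeight_nonneg ha1 N n)]
        refine sum_le_sum_of_subset_of_nonneg (fun n hn => ?_) fun n _ _ =>
          bernsteinWeight_nonneg ha1 N n
        rw [mem_filter] at hn ⊢
        refine ⟨hn.1, ?_⟩
        rw [abs_sub_comm]
        exact le_trans (by linarith [hn.2]) (le_abs_self _)
    have hsplit : bernsteinSum N (fun x => f 0 x) a - f 0 a =
        (bernsteinSum N (fun x => f 1 x) a - f 1 a) +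
          ∑ n ∈ range (N + 1) with bernsteinNode N n < T, (bernsteinWeight N n a : ℂ) *
            (f 0 (bernsteinNode N n) - f 1 (bernsteinNode N n)) := by
      rw [hfa, sum_filter_of_ne]
      · simp only [bernsteinSum, mul_sub, sum_sub_distrib]
        ring
      · intro n _ hn
        by_contra! h
        exact hn (by rw [hf.eq_zero_sheet 1 (by decide) _ (by simpa using h), sub_self, mul_zero])
    rw [hsplit, add_mul, mul_assoc _ (2 * 1 : ℝ)]
    refine (norm_add_le _ _).trans (add_le_add h1 ?_)
    refine (norm_sum_bernsteinWeight_mul_le (M := 2 * 1 * M) fun n hn => ?_).trans ?_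
    · have hb : ‖((bernsteinNode N n : ℝ) : ℂ)‖ ≤ 1 + 4 * r' := by
        rw [Complex.norm_real, Real.norm_eq_abs]
        exact (abs_bernsteinNode_le (mem_filter.1 hn).1).trans (by linarith)
      refine (norm_sub_le _ _).trans ?_
      linarith [hf.norm_le 0 _ hb, hf.norm_le 1 _ hb]
    · gcongr
  intro N hN M f hf a ha ha'
  rcases le_total 0 a with h | h
  · rw [abs_of_nonneg h] at ha ha'
    exact right N hN M f hf a ha ha'
  · rw [abs_of_nonpos h] at ha ha'
    have := right N hN M _ hf.neg (-a) ha ha'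
    rw [bernsteinSum_neg hN] at this
    simpa using this

theorem SheetBound.exists_norm_bernsteinSum_le {T r r' : ℝ} (hT : T ∈ Set.Ico (0 : ℝ) 1)
    (hr0 : 0 < r - 1)
    (hr : ((r - 1) / (1 - T)) ^ (1 - T) * ((r - 1 + 2) / (1 + T)) ^ (1 + T) = 1)
    (hr' : 1 ≤ r') (hlt : r' < r) :
    ∃ N₀ : ℕ, ∀ N : ℕ, 1 ≤ N → N₀ ≤ N → ∀ M f, SheetBound T (1 + 4 * r') M f →
      ∀ a : ℝ, |a| ≤ r' → ‖bernsteinSum N (fun x => f 0 x) a‖ ≤ 2 * M := by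
  obtain ⟨e, he, h⟩ := SheetBound.exists_rate hT hr0 hr hr' hlt
  obtain ⟨N₀, hN₀⟩ := Filter.eventually_atTop.1 (he.eventually_le_const zero_lt_one)
  refine ⟨N₀, fun N hN hNN M f hf a ha => ?_⟩
  have hM := hf.nonneg (by linarith)
  rcases le_total |a| 1 with h1 | h1
  · refine (norm_sum_bernsteinWeight_mul_le fun n hn => hf.norm_le 0 _ ?_).trans ?_
    · rw [Complex.norm_real, Real.norm_eq_abs]
      exact (abs_bernsteinNode_le hn).trans (by linarith)
    · rw [sum_abs_bernsteinWeight h1]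
      linarith
  · have h2 := h N hN M f hf a (by linarith [hT.2]) ha
    have h3 := hf.norm_le 0 a (by rw [Complex.norm_real, Real.norm_eq_abs]; linarith)
    have h4 : e N * M ≤ 1 * M := by gcongr; exact hN₀ N hNN
    have h5 := norm_le_norm_sub_add (bernsteinSum N (fun x => f 0 x) a) (f 0 a)
    linarith

theorem SheetBound.exists_norm_bernsteinSum_sub_le {T r r' : ℝ} (hT : T ∈ Set.Ico (0 : ℝ) 1)
    (hr0 : 0 < r - 1)
    (hr : ((r - 1) / (1 - T)) ^ (1 - T) * ((r - 1 + 2) / (1 + T)) ^ (1 + T) = 1)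
    (hr' : 1 ≤ r') (hlt : r' < r) (M : ℝ) {ε δ : ℝ} (hε : 0 < ε) (hδ : 0 < δ) :
    ∃ N₀ : ℕ, ∀ N : ℕ, 1 ≤ N → N₀ ≤ N → ∀ f, SheetBound T (1 + 4 * r') M f →
      (∀ x y : ℝ, |x| ≤ 1 → |y| ≤ 1 → |x - y| < δ → ‖f 0 x - f 0 y‖ ≤ ε / 2) →
      ∀ a : ℝ, |a| ≤ r' → ‖bernsteinSum N (fun x => f 0 x) a - f 0 a‖ ≤ ε := by
  obtain ⟨e, he, h⟩ := SheetBound.exists_rate hT hr0 hr hr' hlt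
  have he1 : Filter.Tendsto (fun N => e N * M) Filter.atTop (nhds 0) := by
    simpa using he.mul_const M
  have he2 : Filter.Tendsto (fun N : ℕ => 16 / (N * δ ^ 2) * (2 * M)) Filter.atTop (nhds 0) := by
    have := (tendsto_const_div_atTop_nhds_zero_nat (16 / δ ^ 2)).mul_const (2 * M)
    rw [zero_mul] at this
    refine this.congr fun N => ?_
    rw [div_div, mul_comm (δ ^ 2)]
  obtain ⟨N₀, hN₀⟩ := Filter.eventually_atTop.1
    ((he1.eventually_le_const hε).and (he2.eventually_le_const (half_pos hε)))
  refine ⟨N₀, fun N hN hNN f hf hmod a ha => ?_⟩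
  have hM := hf.nonneg (by linarith)
  have hb : ∀ x : ℝ, |x| ≤ 1 → ‖f 0 x‖ ≤ M := fun x hx => hf.norm_le 0 _ (by
    rw [Complex.norm_real, Real.norm_eq_abs]
    linarith)
  rcases le_total |a| 1 with h1 | h1
  · have e1 : bernsteinSum N (fun x => f 0 x) a - f 0 a =
        ∑ n ∈ range (N + 1), (bernsteinWeight N n a : ℂ) * (f 0 (bernsteinNode N n) - f 0 a) := by
      simp only [mul_sub, sum_sub_distrib, ← sum_mul, ← Complex.ofReal_sum, sum_bernsteinWeight]
      simp [bernsteinSum]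
    rw [e1, ← sum_filter_add_sum_filter_not _ fun n => δ ≤ |bernsteinNode N n - a|]
    refine (norm_add_le _ _).trans ((add_le_add (b := ε / 2) (d := ε / 2) ?_ ?_).trans_eq
      (add_halves ε))
    · refine (norm_sum_bernsteinWeight_mul_le (M := 2 * M) fun n hn => ?_).trans
        (le_trans ?_ (hN₀ N hNN).2)
      · refine (norm_sub_le _ _).trans ?_
        linarith [hb a h1, hb _ (abs_bernsteinNode_le (mem_filter.1 hn).1)]
      · rw [sum_congr rfl fun n _ => abs_of_nonneg (bernsteinWeight_nonneg h1 N n)]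
        gcongr
        exact sum_bernsteinWeight_filter_le h1 hδ hN
    · refine (norm_sum_bernsteinWeight_mul_le (M := ε / 2) fun n hn => ?_).trans ?_
      · rw [mem_filter, not_le] at hn
        exact hmod _ _ (abs_bernsteinNode_le hn.1) h1 hn.2
      · refine mul_le_of_le_one_left (half_pos hε).le ?_
        rw [← sum_abs_bernsteinWeight h1 N]
        exact sum_le_sum_of_subset_of_nonneg (filter_subset _ _) fun n _ _ => abs_nonneg _
  · exact (h N hN M f hf a (by linarith [hT.2]) ha).trans (hN₀ N hNN).1

theorem eq_of_eqOn_ray {f g : ℂ → ℂ} (hf : Differentiable ℂ f) (hg : Differentiable ℂ g) {T σ : ℝ}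
    (hσ : σ ≠ 0) (h : ∀ u : ℝ, T ≤ σ * u → f u = g u) : f = g := by
  have hf' : AnalyticOnNhd ℂ f Set.univ := fun z _ => hf.analyticAt z
  have hg' : AnalyticOnNhd ℂ g Set.univ := fun z _ => hg.analyticAt z
  set u₀ : ℝ := (T + 1) / σ with hu₀
  refine hf'.eq_of_frequently_eq hg' (z₀ := (u₀ : ℂ)) ?_
  have h1 : ∀ᶠ u : ℝ in nhdsWithin u₀ {u₀}ᶜ, f u = g u := by
    have h2 : ∀ᶠ u : ℝ in nhds u₀, T < σ * u := by
      have hcont : Continuous fun u : ℝ => σ * u := by fun_prop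
      refine hcont.continuousAt.eventually_const_lt ?_
      change T < σ * u₀
      rw [hu₀, mul_div_cancel₀ _ hσ]
      linarith
    exact (h2.filter_mono nhdsWithin_le_nhds).mono fun u hu => h u hu.le
  have h3 : Filter.Tendsto (fun u : ℝ => (u : ℂ)) (nhdsWithin u₀ {u₀}ᶜ)
      (nhdsWithin (u₀ : ℂ) {(u₀ : ℂ)}ᶜ) := by
    refine tendsto_nhdsWithin_of_tendsto_nhds_of_eventually_within _
      (Complex.continuous_ofReal.continuousAt.tendsto.mono_left nhdsWithin_le_nhds) ?_
    filter_upwards [self_mem_nhdsWithin] with u hu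
    simpa using hu
  exact h3.frequently h1.frequently

/-- A family of functions indexed by a choice of sheet in each coordinate: on the sheets `±1` the
function is entire in that coordinate, and it extends the function on the sheet `0` from the
corresponding ray of real numbers. -/
structure SheetFamily {ι R : Type*} [DecidableEq ι] [TopologicalSpace R] (T : ι → ℝ)
    (Φ : (ι → SignType) → R → (ι → ℂ) → ℂ) : Prop where
  continuous : ∀ s, Continuous fun p : R × (ι → ℂ) => Φ s p.1 p.2
  differentiable : ∀ s x z j, s j ≠ 0 → Differentiable ℂ fun w => Φ s x (Function.update z j w)
  eq_update_zero : ∀ s x z j (u : ℝ), s j ≠ 0 → T j ≤ (s j : ℝ) * u →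
    Φ s x (Function.update z j u) = Φ (Function.update s j 0) x (Function.update z j u)

theorem SheetFamily.of_regular {ι R : Type*} [Fintype ι] [DecidableEq ι] [TopologicalSpace R]
    {T : ι → ℝ} {Φ : (ι → SignType) → R → (ι → ℂ) → ℂ}
    (hc : ∀ s, Continuous fun p : R × (ι → ℂ) => Φ s p.1 p.2)
    (hd : ∀ s x z j, s j ≠ 0 → Differentiable ℂ fun w => Φ s x (Function.update z j w))
    (hreg : ∀ s x z, (∀ j, s j ≠ 0 → (z j).im = 0 ∧ T j ≤ (s j : ℝ) * (z j).re) →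
      Φ s x z = Φ 0 x z) : SheetFamily T Φ := by
  refine ⟨hc, hd, fun s x z j u hj hu => ?_⟩
  have key : ∀ A : Finset ι, ∀ z : ι → ℂ, z j = u →
      (∀ i ∉ A, s i ≠ 0 → (z i).im = 0 ∧ T i ≤ (s i : ℝ) * (z i).re) →
      Φ s x z = Φ (Function.update s j 0) x z := by
    intro A
    induction A using Finset.induction_on with
    | empty =>
      intro z hz h
      rw [hreg s x z fun i hi => h i (notMem_empty i) hi, hreg (Function.update s j 0)]
      intro i hi
      rcases eq_or_ne i j with rfl | hij
      · simp at hi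
      · rw [Function.update_of_ne hij] at hi ⊢
        exact h i (notMem_empty i) hi
    | insert i A hiA ih =>
      intro z hz h
      rcases eq_or_ne i j with rfl | hij
      · refine ih z hz fun l hl hsl => ?_
        rcases eq_or_ne l i with rfl | hli
        · simpa [hz] using hu
        · exact h l (by simp [hli, hl]) hsl
      by_cases hsi : s i = 0
      · refine ih z hz fun l hl hsl => h l ?_ hsl
        have : l ≠ i := by rintro rfl; exact hsl hsi
        simp [this, hl]
      have hupd : Function.update s j 0 i ≠ 0 := by rwa [Function.update_of_ne hij]
      have hsi' : (s i : ℝ) ≠ 0 := by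
        generalize s i = σ at hsi
        rcases σ with _ | _ | _ <;> simp_all
      have h1 := eq_of_eqOn_ray (T := T i) (σ := (s i : ℝ)) (hd s x z i hsi)
        (hd (Function.update s j 0) x z i hupd) hsi' fun v hv => ?_
      · have := congrFun h1 (z i)
        simpa using this
      · refine ih _ (by rwa [Function.update_of_ne hij.symm]) fun l hl hsl => ?_
        rcases eq_or_ne l i with rfl | hli
        · simpa using hv
        · rw [Function.update_of_ne hli]
          exact h l (by simp [hli, hl]) hsl
  exact key univ _ (by simp) fun i hi => absurd (mem_univ i) hi

theorem SheetFamily.comp_mul {ι R : Type*} [Fintype ι] [DecidableEq ι] [TopologicalSpace R]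
    {T : ι → ℝ} {Φ : (ι → SignType) → R → (ι → ℂ) → ℂ} (h : SheetFamily T Φ)
    (hT : ∀ j, 0 ≤ T j) {c : ι → ℝ} (hc : ∀ j, 1 ≤ c j) :
    SheetFamily T fun s x z => Φ s x fun j => c j * z j := by
  have hupd : ∀ (z : ι → ℂ) (j : ι) (w : ℂ), (fun i => (c i : ℂ) * Function.update z j w i) =
      Function.update (fun i => (c i : ℂ) * z i) j (c j * w) := by
    intro z j w
    funext i
    rcases eq_or_ne i j with rfl | hij
    · simp
    · simp [hij]
  refine ⟨fun s => ?_, fun s x z j hj => ?_, fun s x z j u hj hu => ?_⟩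
  · exact (h.continuous s).comp (by fun_prop : Continuous fun p : R × (ι → ℂ) =>
      (p.1, fun j => (c j : ℂ) * p.2 j))
  · simp only [hupd]
    exact (h.differentiable s x _ j hj).comp (differentiable_id.const_mul _)
  · simp only [hupd]
    rw [← Complex.ofReal_mul]
    refine h.eq_update_zero s x _ j _ hj ?_
    nlinarith [hT j, hc j]

theorem exists_sheetFamily {R : Type*} [MetricSpace R] (m : ℕ)
    (T : Fin m → ℝ) (φ : (Fin m → ℝ) × R → ℂ) (hφ : Continuous φ)
    (hpred : ∀ Jm Jp : Finset (Fin m), Disjoint Jm Jp → (Jm ∪ Jp).Nonempty →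
      ∃ F : ({j : Fin m // j ∉ Jm ∪ Jp} → ℝ) → R → ({j : Fin m // j ∈ Jm ∪ Jp} → ℂ) → ℂ,
        (∀ α x, Differentiable ℂ (F α x)) ∧
        (∀ α₀ : {j : Fin m // j ∉ Jm ∪ Jp} → ℝ, ∀ x₀ : R,
          ∀ K' : Set ({j : Fin m // j ∈ Jm ∪ Jp} → ℂ), IsCompact K' → ∀ ε > 0, ∃ δ > 0,
            ∀ α : {j : Fin m // j ∉ Jm ∪ Jp} → ℝ, dist α α₀ < δ → ∀ x : R, dist x x₀ < δ →
              ∀ w ∈ K', ‖F α x w - F α₀ x₀ w‖ < ε) ∧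
        (∀ a : Fin m → ℝ, (∀ j ∈ Jm, a j ≤ -T j) → (∀ j ∈ Jp, T j ≤ a j) → ∀ x : R,
          φ (a, x) = F (fun j => a j.1) x (fun j => (a j.1 : ℂ)))) :
    ∃ Φ : (Fin m → SignType) → R → (Fin m → ℂ) → ℂ,
      SheetFamily T Φ ∧ ∀ x z, Φ 0 x z = φ (fun j => (z j).re, x) := by
  have key : ∀ s : Fin m → SignType, ∃ Ψ : R → (Fin m → ℂ) → ℂ,
      Continuous (fun p : R × (Fin m → ℂ) => Ψ p.1 p.2) ∧
      (∀ x z j, s j ≠ 0 → Differentiable ℂ fun w => Ψ x (Function.update z j w)) ∧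
      (∀ x z, (∀ j, s j ≠ 0 → (z j).im = 0 ∧ T j ≤ (s j : ℝ) * (z j).re) →
        Ψ x z = φ (fun j => (z j).re, x)) ∧
      (s = 0 → ∀ x z, Ψ x z = φ (fun j => (z j).re, x)) := by
    intro s
    rcases eq_or_ne s 0 with rfl | hs
    · refine ⟨fun x z => φ (fun j => (z j).re, x), ?_, fun x z j hj => absurd rfl hj,
        fun _ _ _ => rfl, fun _ _ _ => rfl⟩
      exact hφ.comp (by fun_prop)
    obtain ⟨i, hi⟩ := Function.ne_iff.1 hs
    set Jm := univ.filter fun j => s j = -1 with hJm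
    set Jp := univ.filter fun j => s j = 1 with hJp
    have hmem : ∀ j, j ∈ Jm ∪ Jp ↔ s j ≠ 0 := by
      intro j
      simp only [hJm, hJp, mem_union, mem_filter, mem_univ, true_and]
      rcases s j with _ | _ | _ <;> decide
    have hdisj : Disjoint Jm Jp := by
      rw [Finset.disjoint_left]
      intro j hj hj'
      rw [mem_filter] at hj hj'
      have := hj.2.symm.trans hj'.2
      exact absurd this (by decide)
    obtain ⟨F, hFd, hFc, hFe⟩ := hpred Jm Jp hdisj ⟨i, (hmem i).2 hi⟩
    refine ⟨fun x z => F (fun j => (z j.1).re) x fun j => z j.1, ?_, ?_, ?_,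
      fun h => absurd h hs⟩
    · have hF : Continuous fun p : (({j : Fin m // j ∉ Jm ∪ Jp} → ℝ) × R) ×
          ({j : Fin m // j ∈ Jm ∪ Jp} → ℂ) => F p.1.1 p.1.2 p.2 := by
        rw [continuous_iff_continuousAt]
        rintro ⟨⟨α₀, x₀⟩, w₀⟩
        rw [Metric.continuousAt_iff]
        intro ε hε
        obtain ⟨δ₁, hδ₁, h1⟩ := hFc α₀ x₀ (Metric.closedBall w₀ 1)
          (isCompact_closedBall w₀ 1) (ε / 2) (half_pos hε)
        obtain ⟨δ₂, hδ₂, h2⟩ := Metric.continuousAt_iff.1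
          ((hFd α₀ x₀).continuous.continuousAt (x := w₀)) (ε / 2) (half_pos hε)
        refine ⟨min δ₁ (min δ₂ 1), by positivity, ?_⟩
        rintro ⟨⟨α, x⟩, w⟩ hd
        rw [Prod.dist_eq, max_lt_iff, Prod.dist_eq, max_lt_iff] at hd
        obtain ⟨⟨hα, hx⟩, hw⟩ := hd
        rw [lt_min_iff] at hα hx hw
        rw [lt_min_iff] at hw
        have h3 := h1 α hα.1 x hx.1 w (Metric.mem_closedBall.2 hw.2.2.le)
        have h4 := h2 hw.2.1
        rw [← dist_eq_norm] at h3
        linarith [dist_triangle (F α x w) (F α₀ x₀ w) (F α₀ x₀ w₀)]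
      exact hF.comp (by fun_prop : Continuous fun p : R × (Fin m → ℂ) =>
        (((fun j : {j : Fin m // j ∉ Jm ∪ Jp} => (p.2 j.1).re), p.1),
          fun j : {j : Fin m // j ∈ Jm ∪ Jp} => p.2 j.1))
    · intro x z j hj
      have hα : ∀ w, (fun l : {j : Fin m // j ∉ Jm ∪ Jp} => (Function.update z j w l.1).re) =
          fun l => (z l.1).re := by
        intro w
        funext l
        have : l.1 ≠ j := by
          intro h
          exact l.2 ((hmem _).2 (h ▸ hj))
        rw [Function.update_of_ne this]
      simp only [hα]
      refine (hFd _ x).comp ?_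
      rw [differentiable_pi]
      intro l
      rcases eq_or_ne l.1 j with h | h
      · simp only [h, Function.update_self]
        exact differentiable_id
      · simp only [Function.update_of_ne h]
        exact differentiable_const _
    · intro x z hz
      have hz' : ∀ l : {j : Fin m // j ∈ Jm ∪ Jp}, (((z l.1).re : ℝ) : ℂ) = z l.1 := by
        intro l
        apply Complex.ext <;> simp [(hz l.1 ((hmem _).1 l.2)).1]
      rw [hFe (fun j => (z j).re) _ _ x]
      · simp only [hz']
      · intro j hj
        have hj' := (mem_filter.1 hj).2
        have := (hz j (by rw [hj']; decide)).2
        rw [hj'] at this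
        simp at this
        linarith
      · intro j hj
        have hj' := (mem_filter.1 hj).2
        have := (hz j (by rw [hj']; decide)).2
        rw [hj'] at this
        simpa using this
  choose Φ hc hd hreg h0 using key
  exact ⟨Φ, SheetFamily.of_regular hc hd fun s x z h => by rw [hreg s x z h, h0 0 rfl],
    fun x z => h0 0 rfl x z⟩

/-- The Bernstein sum of `G` in the coordinates belonging to `A`, the others being fixed. -/
noncomputable def partialBernsteinSum {ι : Type*} [Fintype ι] [DecidableEq ι] (A : Finset ι)
    (N : ι → ℕ) (G : (ι → ℂ) → ℂ) (z : ι → ℂ) : ℂ :=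
  ∑ ν ∈ Fintype.piFinset fun j => if j ∈ A then range (N j + 1) else {0},
    (∏ j ∈ A, (bernsteinWeight (N j) (ν j) (z j).re : ℂ)) *
      G fun j => if j ∈ A then (bernsteinNode (N j) (ν j) : ℂ) else z j

section
variable {ι : Type*} [Fintype ι] [DecidableEq ι]

theorem partialBernsteinSum_empty (N : ι → ℕ) (G : (ι → ℂ) → ℂ) (z : ι → ℂ) :
    partialBernsteinSum ∅ N G z = G z := by
  simp [partialBernsteinSum]

theorem partialBernsteinSum_update {A : Finset ι} {j : ι} (hj : j ∉ A) (N : ι → ℕ)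
    (G : (ι → ℂ) → ℂ) (z : ι → ℂ) (w : ℂ) :
    partialBernsteinSum A N G (Function.update z j w) =
      ∑ ν ∈ Fintype.piFinset fun j => if j ∈ A then range (N j + 1) else {0},
        (∏ j ∈ A, (bernsteinWeight (N j) (ν j) (z j).re : ℂ)) *
          G (Function.update
            (fun j => if j ∈ A then (bernsteinNode (N j) (ν j) : ℂ) else z j) j w) := by
  refine sum_congr rfl fun ν _ => ?_
  congr 1
  · refine prod_congr rfl fun i hi => ?_
    rw [Function.update_of_ne (ne_of_mem_of_not_mem hi hj)]
  · congr 1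
    funext i
    rcases eq_or_ne i j with rfl | hij
    · simp [hj]
    · simp [hij]

theorem partialBernsteinSum_insert {A : Finset ι} {j : ι} (hj : j ∉ A) (N : ι → ℕ)
    (G : (ι → ℂ) → ℂ) (z : ι → ℂ) :
    partialBernsteinSum (insert j A) N G z =
      bernsteinSum (N j) (fun x => partialBernsteinSum A N G (Function.update z j x)) (z j).re := by
  simp only [bernsteinSum, partialBernsteinSum_update hj, mul_sum]
  rw [← sum_product', partialBernsteinSum]
  symm
  have hne : ∀ {i}, i ∈ A → i ≠ j := fun hi => ne_of_mem_of_not_mem hi hj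
  refine sum_nbij' (fun p => Function.update p.2 j p.1)
    (fun ν => (ν j, Function.update ν j 0)) ?_ ?_ ?_ ?_ ?_
  · rintro ⟨n, ν⟩ h
    rw [mem_product, Fintype.mem_piFinset] at h
    rw [Fintype.mem_piFinset]
    intro i
    rcases eq_or_ne i j with rfl | hij
    · simpa using h.1
    · simpa [hij] using h.2 i
  · intro ν h
    rw [Fintype.mem_piFinset] at h
    rw [mem_product, Fintype.mem_piFinset]
    refine ⟨by simpa using h j, fun i => ?_⟩
    rcases eq_or_ne i j with rfl | hij
    · simp [hj]
    · simpa [hij] using h i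
  · rintro ⟨n, ν⟩ h
    rw [mem_product, Fintype.mem_piFinset] at h
    have h0 : ν j = 0 := by simpa [hj] using h.2 j
    ext1
    · simp
    · simp [← h0]
  · intro ν _
    simp
  · rintro ⟨n, ν⟩ _
    rw [prod_insert hj, ← mul_assoc]
    congr 1
    · congr 1
      · simp
      · refine prod_congr rfl fun i hi => ?_
        simp [hne hi]
    · congr 1
      funext i
      rcases eq_or_ne i j with rfl | hij
      · simp
      · simp [hij]

theorem SheetFamily.exists_norm_partialBernsteinSum_sub_le {R : Type*} [PseudoMetricSpace R]
    {T r r' : ι → ℝ} {Φ : (ι → SignType) → R → (ι → ℂ) → ℂ} (hΦ : SheetFamily T Φ)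
    (hT : ∀ j, T j ∈ Set.Ico (0 : ℝ) 1)
    (hr : ∀ j, 0 < r j - 1 ∧
      ((r j - 1) / (1 - T j)) ^ (1 - T j) * ((r j - 1 + 2) / (1 + T j)) ^ (1 + T j) = 1)
    (hr' : ∀ j, 1 ≤ r' j) (hlt : ∀ j, r' j < r j) {D : ℝ} (hD : ∀ j, 1 + 4 * r' j ≤ D)
    {K : Set R} (hK : IsCompact K) (A : Finset ι) :
    ∀ s : ι → SignType, (∀ j ∈ A, s j = 0) → ∀ ε > 0, ∃ M : ℕ, ∀ N : ι → ℕ,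
      (∀ j, 1 ≤ N j) → (∀ j, M ≤ N j) → ∀ x ∈ K, ∀ z : ι → ℂ,
        (∀ j ∈ A, (z j).im = 0 ∧ |(z j).re| ≤ r' j) → (∀ j ∉ A, ‖z j‖ ≤ D) →
          ‖partialBernsteinSum A N (Φ s x) z - Φ s x z‖ ≤ ε := by
  induction A using Finset.induction_on with
  | empty =>
    intro s _ ε hε
    refine ⟨0, fun N _ _ x _ z _ _ => ?_⟩
    rw [partialBernsteinSum_empty, sub_self, norm_zero]
    exact hε.le
  | insert j A hj ih =>
    intro s hs ε hε
    have hsj : s j = 0 := hs j (mem_insert_self j A)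
    have hs0 : Function.update s j 0 = s := by rw [← hsj, Function.update_eq_self]
    have hD0 : 0 ≤ D := by linarith [hr' j, hD j]
    have hsσ : ∀ σ, ∀ i ∈ A, Function.update s j σ i = 0 := fun σ i hi => by
      rw [Function.update_of_ne (ne_of_mem_of_not_mem hi hj)]
      exact hs i (mem_insert_of_mem hi)
    have hcomp : IsCompact (K ×ˢ Metric.closedBall (0 : ι → ℂ) D) :=
      hK.prod (isCompact_closedBall 0 D)
    choose M hM using fun σ => ih (Function.update s j σ) (hsσ σ) (ε / 4) (by positivity)
    obtain ⟨M₁, hM₁⟩ := (Set.finite_range M).bddAbove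
    choose B hB using fun σ => hcomp.exists_bound_of_continuousOn
      (hΦ.continuous (Function.update s j σ)).continuousOn
    obtain ⟨B₁, hB₁⟩ := (Set.finite_range B).bddAbove
    obtain ⟨δ, hδ, hunif⟩ := Metric.uniformContinuousOn_iff.1
      (hcomp.uniformContinuousOn_of_continuous (hΦ.continuous s).continuousOn) (ε / 2 / 2)
      (by positivity)
    obtain ⟨M₂, hM₂⟩ := SheetBound.exists_norm_bernsteinSum_le (hT j) (hr j).1 (hr j).2
      (hr' j) (hlt j)
    obtain ⟨M₃, hM₃⟩ := SheetBound.exists_norm_bernsteinSum_sub_le (hT j) (hr j).1 (hr j).2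
      (hr' j) (hlt j) B₁ (half_pos hε) hδ
    refine ⟨max M₁ (max M₂ M₃), fun N hN1 hN x hx z hz hzD => ?_⟩
    have hN₁ : ∀ i, M₁ ≤ N i := fun i => (le_max_left _ _).trans (hN i)
    have hN₂ : M₂ ≤ N j := (le_max_left _ _).trans ((le_max_right _ _).trans (hN j))
    have hN₃ : M₃ ≤ N j := (le_max_right _ _).trans ((le_max_right _ _).trans (hN j))
    have hball : ∀ w : ℂ, ‖w‖ ≤ D → (x, Function.update z j w) ∈
        K ×ˢ Metric.closedBall (0 : ι → ℂ) D := by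
      intro w hw
      refine ⟨hx, ?_⟩
      rw [mem_closedBall_zero_iff, pi_norm_le_iff_of_nonneg hD0]
      intro i
      change ‖Function.update z j w i‖ ≤ D
      rcases eq_or_ne i j with rfl | hij
      · simpa using hw
      rw [Function.update_of_ne hij]
      by_cases hi : i ∈ A
      · obtain ⟨h1, h2⟩ := hz i (mem_insert_of_mem hi)
        have h3 : ((z i).re : ℂ) = z i := by apply Complex.ext <;> simp [h1]
        rw [← h3, Complex.norm_real, Real.norm_eq_abs]
        linarith [hD i, hr' i]
      · exact hzD i (by simp [hij, hi])
    have hzj : (((z j).re : ℝ) : ℂ) = z j := by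
      apply Complex.ext <;> simp [(hz j (mem_insert_self j A)).1]
    set g : SignType → ℂ → ℂ := fun σ w =>
      Φ (Function.update s j σ) x (Function.update z j w) with hg
    set f : SignType → ℂ → ℂ := fun σ w =>
      partialBernsteinSum A N (Φ (Function.update s j σ) x) (Function.update z j w) - g σ w with hf
    have hdiff : ∀ σ, σ ≠ 0 → ∀ z', Differentiable ℂ fun w =>
        Φ (Function.update s j σ) x (Function.update z' j w) := fun σ hσ z' =>
      hΦ.differentiable _ x z' j (by simpa using hσ)
    have heq : ∀ σ : SignType, σ ≠ 0 → ∀ u : ℝ, T j ≤ (σ : ℝ) * u → ∀ z',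
        Φ (Function.update s j σ) x (Function.update z' j u) =
          Φ (Function.update s j 0) x (Function.update z' j u) := by
      intro σ hσ u hu z'
      rw [hΦ.eq_update_zero _ x z' j u (by simpa using hσ) (by simpa using hu),
        Function.update_idem]
    have hgS : SheetBound (T j) (1 + 4 * r' j) B₁ g := by
      refine ⟨fun σ hσ => hdiff σ hσ z, fun σ hσ u hu => heq σ hσ u hu z, fun σ w hw => ?_⟩
      exact (hB σ _ (hball w (hw.trans (hD j)))).trans (hB₁ (Set.mem_range_self σ))
    have hfS : SheetBound (T j) (1 + 4 * r' j) (ε / 4) f := by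
      refine ⟨fun σ hσ => ?_, fun σ hσ u hu => ?_, fun σ w hw => ?_⟩
      · refine Differentiable.sub ?_ (hdiff σ hσ z)
        simp only [partialBernsteinSum_update hj]
        exact Differentiable.fun_sum fun ν _ => (hdiff σ hσ _).const_mul _
      · simp only [hf, hg, partialBernsteinSum_update hj, heq σ hσ u hu]
      · refine hM σ N hN1 (fun i => (hM₁ (Set.mem_range_self σ)).trans (hN₁ i)) x hx _
          (fun i hi => ?_) fun i hi => ?_
        · rw [Function.update_of_ne (ne_of_mem_of_not_mem hi hj)]
          exact hz i (mem_insert_of_mem hi)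
        · rcases eq_or_ne i j with rfl | hij
          · simpa using hw.trans (hD i)
          · rw [Function.update_of_ne hij]
            exact hzD i (by simp [hij, hi])
    have ha := (hz j (mem_insert_self j A)).2
    have h1 := hM₂ (N j) (hN1 j) hN₂ _ f hfS _ ha
    have h2 := hM₃ (N j) (hN1 j) hN₃ g hgS (fun u v hu hv huv => ?_) _ ha
    · have h3 : partialBernsteinSum (insert j A) N (Φ s x) z - Φ s x z =
          bernsteinSum (N j) (fun u => f 0 u) (z j).re +
            (bernsteinSum (N j) (fun u => g 0 u) (z j).re - g 0 (z j).re) := by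
        rw [partialBernsteinSum_insert hj]
        simp only [hf, hg, hs0, bernsteinSum, mul_sub, sum_sub_distrib, hzj,
          Function.update_eq_self]
        ring
      rw [h3]
      refine (norm_add_le _ _).trans ?_
      linarith
    · have hu' : ‖(u : ℂ)‖ ≤ D := by
        rw [Complex.norm_real, Real.norm_eq_abs]
        linarith [hD j, hr' j]
      have hv' : ‖(v : ℂ)‖ ≤ D := by
        rw [Complex.norm_real, Real.norm_eq_abs]
        linarith [hD j, hr' j]
      simp only [hg, hs0]
      rw [← dist_eq_norm]
      refine (hunif _ (hball u hu') _ (hball v hv') ?_).le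
      rw [Prod.dist_eq, dist_self, max_lt_iff]
      refine ⟨hδ, (dist_pi_lt_iff hδ).2 fun i => ?_⟩
      rcases eq_or_ne i j with rfl | hij
      · simpa [dist_eq_norm, ← Complex.ofReal_sub, Complex.norm_real] using huv
      · simpa [hij] using hδ

theorem partialBernsteinSum_univ (N : ι → ℕ) (G : (ι → ℂ) → ℂ) (z : ι → ℂ) :
    partialBernsteinSum univ N G z =
      ∑ ν ∈ Fintype.piFinset fun j => range (N j + 1),
        (∏ j, (bernsteinWeight (N j) (ν j) (z j).re : ℂ)) *
          G fun j => (bernsteinNode (N j) (ν j) : ℂ) := by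
  simp [partialBernsteinSum]

end

end

/-- (Theorem 3.1, Bernstein ρ-pseudo-autosimilarity) If `φ : ℝ^m × R → ℂ` is
continuous and `T`-predictable, then for any `ρ` with `1 < ρ_j < r(T_j)` and any
`k ∈ ℕ`, the Bernstein sums with coefficients sampled at `ρ^{-k}·a` and `φ` evaluated
at the dilated nodes `ρ^k·(1 - 2ν/N)` converge to `φ(a,x)` uniformly on every compact
subset of `(∏_j (-ρ_j^k r(T_j), ρ_j^k r(T_j))) × R` as `min_j N_j → ∞`. Here
`r(T_j) = 1 + ρ(T_j)` with `ρ(T_j)` the unique positive root of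
`(ρ/(1-T_j))^{1-T_j}((ρ+2)/(1+T_j))^{1+T_j} = 1`. -/
theorem statement_13 {R : Type*} [MetricSpace R] (m : ℕ) (hm : 1 ≤ m)
    (T : Fin m → ℝ) (hT : ∀ j, T j ∈ Set.Ico (0 : ℝ) 1)
    (r : Fin m → ℝ)
    (hr : ∀ j, 0 < r j - 1 ∧
      ((r j - 1) / (1 - T j)) ^ (1 - T j) * ((r j - 1 + 2) / (1 + T j)) ^ (1 + T j) = 1)
    (φ : (Fin m → ℝ) × R → ℂ) (hφ : Continuous φ)
    (hpred : ∀ Jm Jp : Finset (Fin m), Disjoint Jm Jp → (Jm ∪ Jp).Nonempty →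
      ∃ F : ({j : Fin m // j ∉ Jm ∪ Jp} → ℝ) → R → ({j : Fin m // j ∈ Jm ∪ Jp} → ℂ) → ℂ,
        (∀ α x, Differentiable ℂ (F α x)) ∧
        (∀ α₀ : {j : Fin m // j ∉ Jm ∪ Jp} → ℝ, ∀ x₀ : R,
          ∀ K' : Set ({j : Fin m // j ∈ Jm ∪ Jp} → ℂ), IsCompact K' → ∀ ε > 0, ∃ δ > 0,
            ∀ α : {j : Fin m // j ∉ Jm ∪ Jp} → ℝ, dist α α₀ < δ → ∀ x : R, dist x x₀ < δ →
              ∀ w ∈ K', ‖F α x w - F α₀ x₀ w‖ < ε) ∧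
        (∀ a : Fin m → ℝ, (∀ j ∈ Jm, a j ≤ -T j) → (∀ j ∈ Jp, T j ≤ a j) → ∀ x : R,
          φ (a, x) = F (fun j => a j.1) x (fun j => (a j.1 : ℂ))))
    (ρ : Fin m → ℝ) (hρ : ∀ j, 1 < ρ j ∧ ρ j < r j) (k : ℕ) :
    ∀ K : Set ((Fin m → ℝ) × R), IsCompact K → K ⊆ {p | ∀ j, |p.1 j| < ρ j ^ k * r j} →
      ∀ ε > 0, ∃ M : ℕ, ∀ N : Fin m → ℕ, (∀ j, 1 ≤ N j) → (∀ j, M ≤ N j) →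
        ∀ p ∈ K,
          ‖(∑ ν ∈ Fintype.piFinset fun j => Finset.range (N j + 1),
              (∏ j, ((N j).choose (ν j) : ℂ) *
                (((1 - p.1 j / ρ j ^ k) / 2 : ℝ) : ℂ) ^ (ν j) *
                (((1 + p.1 j / ρ j ^ k) / 2 : ℝ) : ℂ) ^ (N j - ν j)) *
              φ (fun j => ρ j ^ k * (1 - 2 * (ν j : ℝ) / (N j : ℝ)), p.2)) - φ p‖ < ε := by
  intro K hK hKsub ε hε
  obtain ⟨Φ, hΦ, hΦ0⟩ := exists_sheetFamily m T φ hφ hpred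
  have hc1 : ∀ j, 1 ≤ ρ j ^ k := fun j => one_le_pow₀ (hρ j).1.le
  have hc0 : ∀ j, 0 < ρ j ^ k := fun j => zero_lt_one.trans_le (hc1 j)
  have hradius : ∀ j, ∃ r' : ℝ, 1 ≤ r' ∧ r' < r j ∧ ∀ p ∈ K, |p.1 j / ρ j ^ k| ≤ r' := by
    intro j
    rcases K.eq_empty_or_nonempty with rfl | hne
    · exact ⟨1, le_rfl, by linarith [(hr j).1], by simp⟩
    have hcont : Continuous fun p : (Fin m → ℝ) × R => |p.1 j / ρ j ^ k| := by fun_prop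
    obtain ⟨p, hp, hmax⟩ := hK.exists_isMaxOn hne hcont.continuousOn
    refine ⟨max 1 |p.1 j / ρ j ^ k|, le_max_left _ _, max_lt (by linarith [(hr j).1]) ?_,
      fun q hq => (hmax hq).trans (le_max_right _ _)⟩
    rw [abs_div, abs_of_pos (hc0 j), div_lt_iff₀ (hc0 j), mul_comm]
    exact hKsub hp j
  choose r' hr'1 hr'r hr'K using hradius
  obtain ⟨D, hD⟩ := (Set.finite_range fun j => 1 + 4 * r' j).bddAbove
  obtain ⟨M, hM⟩ := (hΦ.comp_mul (fun j => (hT j).1) hc1).exists_norm_partialBernsteinSum_sub_le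
    hT hr hr'1 hr'r (fun j => hD (Set.mem_range_self j)) (hK.image continuous_snd) Finset.univ 0
    (fun _ _ => rfl) (ε / 2) (half_pos hε)
  refine ⟨M, fun N hN1 hN p hp => lt_of_le_of_lt ?_ (half_lt_self hε)⟩
  have h := hM N hN1 hN p.2 (Set.mem_image_of_mem _ hp) (fun j => ((p.1 j / ρ j ^ k : ℝ) : ℂ))
    (fun j _ => ⟨Complex.ofReal_im _, by simpa only [Complex.ofReal_re] using hr'K j p hp⟩)
    fun j hj => absurd (Finset.mem_univ j) hj
  rw [partialBernsteinSum_univ] at h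
  simp only [hΦ0, ← Complex.ofReal_mul, Complex.ofReal_re] at h
  have hp' : (fun j => ρ j ^ k * (p.1 j / ρ j ^ k)) = p.1 := by
    funext j
    rw [mul_div_cancel₀ _ (hc0 j).ne']
  rw [hp'] at h
  simpa only [bernsteinWeight, bernsteinNode, Complex.ofReal_mul, Complex.ofReal_pow,
    Complex.ofReal_natCast] using h
end

section
/- Let Φ : ℝ → ℂ be an integrable function with compact support (playing the role of the spectrum Ψ̂ of a wavelet, as for Shannon's or Meyer's wavelet). For (τ, α, ω) ∈ ℝ³ define ψ_{τ,α,ω}(t, x) := (2^{−α/2}/(2π)) ∫_ℝ Φ(ξ) exp( i ( −τ ξ/2^α + (ω + ξ/2^α) x − (ω + ξ/2^α)² t ) ) dξ for (t, x) ∈ (0,∞) × ℝ. Then for every (τ, α, ω) ∈ ℝ³ and every compact subset K of (0,∞) × ℝ, sup over (t,x) ∈ K of | Σ_{ν_1=0}^{N_1} Σ_{ν_2=0}^{N_2} Σ_{ν_3=0}^{N_3} binom(N_1, ν_1) binom(N_2, ν_2) binom(N_3, ν_3) ((1−τ)/2)^{ν_1} ((1+τ)/2)^{N_1−ν_1} ((1−α)/2)^{ν_2}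 ((1+α)/2)^{N_2−ν_2} ((1−ω)/2)^{ν_3} ((1+ω)/2)^{N_3−ν_3} · ψ_{1−2ν_1/N_1, 1−2ν_2/N_2, 1−2ν_3/N_3}(t, x) − ψ_{τ,α,ω}(t, x) | tends to 0 as min(N_1, N_2, N_3) → ∞. -/
open MeasureTheory

open Filter Topology Finset

/-- The Bernstein operator of degree `N`, applied to `f` and evaluated at `x ∈ ℂ`. -/
noncomputable def bernsteinOp (N : ℕ) (x : ℂ) (f : ℂ → ℂ) : ℂ :=
  ∑ ν ∈ range (N + 1), (N.choose ν : ℂ) * x ^ ν * (1 - x) ^ (N - ν) * f ((ν : ℂ) / N)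

namespace bernsteinOp

theorem apply_sub (N : ℕ) (x : ℂ) (f g : ℂ → ℂ) :
    bernsteinOp N x (fun z => f z - g z) = bernsteinOp N x f - bernsteinOp N x g := by
  simp only [bernsteinOp, mul_sub, sum_sub_distrib]

theorem differentiable (N : ℕ) (x : ℂ) {f : ℂ → ℂ → ℂ}
    (hf : ∀ w, Differentiable ℂ fun z => f z w) :
    Differentiable ℂ fun z => bernsteinOp N x (f z) := by
  simp only [bernsteinOp]
  fun_prop

theorem integral_mul {μ : Measure ℝ} (N : ℕ) (x : ℂ) {Φ : ℝ → ℂ} {F : ℂ → ℝ → ℂ}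
    (hF : ∀ z, Integrable (fun ξ => Φ ξ * F z ξ) μ) :
    Integrable (fun ξ => Φ ξ * bernsteinOp N x fun z => F z ξ) μ ∧
      ∫ ξ, Φ ξ * bernsteinOp N x (fun z => F z ξ) ∂μ =
        bernsteinOp N x fun z => ∫ ξ, Φ ξ * F z ξ ∂μ := by
  have h (ξ : ℝ) : Φ ξ * bernsteinOp N x (fun z => F z ξ) =
      ∑ ν ∈ range (N + 1), (N.choose ν : ℂ) * x ^ ν * (1 - x) ^ (N - ν) *
        (Φ ξ * F ((ν : ℂ) / N) ξ) := by
    rw [bernsteinOp, mul_sum]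
    exact sum_congr rfl fun ν _ => by ring
  simp only [h]
  refine ⟨integrable_finsetSum _ fun ν _ => (hF _).const_mul _, ?_⟩
  rw [integral_finsetSum _ fun ν _ => (hF _).const_mul _, bernsteinOp]
  exact sum_congr rfl fun ν _ => integral_const_mul _ _

theorem const_one (N : ℕ) (x : ℂ) : bernsteinOp N x (fun _ => 1) = 1 := by
  have h := add_pow x (1 - x) N
  rw [add_sub_cancel, one_pow] at h
  rw [bernsteinOp]
  exact (sum_congr rfl fun ν _ => by ring).trans h.symm

theorem zero_pow_succ (k : ℕ) (x : ℂ) : bernsteinOp 0 x (fun z => z ^ (k + 1)) = 0 := by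
  simp [bernsteinOp]

theorem succ_pow_succ (N k : ℕ) (x : ℂ) :
    bernsteinOp (N + 1) x (fun z => z ^ (k + 1)) =
      x * ∑ j ∈ range (k + 1), ((N : ℂ) / (N + 1 : ℕ)) ^ j * (1 / ((N + 1 : ℕ) : ℂ)) ^ (k - j) *
        (k.choose j) * bernsteinOp N x (fun z => z ^ j) := by
  have hN : ((N + 1 : ℕ) : ℂ) ≠ 0 := Nat.cast_ne_zero.2 N.succ_ne_zero
  rw [bernsteinOp, sum_range_succ']
  simp only [bernsteinOp, mul_sum]
  rw [sum_comm]
  simp only [Nat.cast_zero, zero_div, ne_eq, Nat.add_eq_zero_iff, one_ne_zero, and_false,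
    not_false_eq_true, zero_pow, mul_zero, add_zero]
  refine sum_congr rfl fun ν hν => ?_
  have hc : ((N + 1).choose (ν + 1) : ℂ) * (((ν + 1 : ℕ) : ℂ) / (N + 1 : ℕ)) = N.choose ν := by
    rw [← mul_div_assoc, div_eq_iff hN]
    exact_mod_cast (Nat.add_one_mul_choose_eq N ν).symm.trans (mul_comm _ _)
  have hs : (((ν + 1 : ℕ) : ℂ) / (N + 1 : ℕ)) =
      (N : ℂ) / (N + 1 : ℕ) * ((ν : ℂ) / N) + 1 / (N + 1 : ℕ) := by
    rcases eq_or_ne N 0 with rfl | h0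
    · have : ν = 0 := by simpa using hν
      subst this; simp
    · have : (N : ℂ) ≠ 0 := Nat.cast_ne_zero.2 h0
      field_simp
      push_cast
      ring
  rw [pow_succ (((ν + 1 : ℕ) : ℂ) / (N + 1 : ℕ)) k, Nat.add_sub_add_right]
  calc _ = ((N + 1).choose (ν + 1) : ℂ) * (((ν + 1 : ℕ) : ℂ) / (N + 1 : ℕ)) * x ^ (ν + 1) *
        (1 - x) ^ (N - ν) * (((ν + 1 : ℕ) : ℂ) / (N + 1 : ℕ)) ^ k := by ring
    _ = _ := by
      rw [hc, hs, add_pow, mul_sum]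
      refine sum_congr rfl fun j _ => ?_
      rw [mul_pow]
      ring

theorem norm_pow_le {x : ℂ} {R : ℝ} (hR : 1 ≤ R) (hx : ‖x‖ ≤ R) (k N : ℕ) :
    ‖bernsteinOp N x (fun z => z ^ k)‖ ≤ R ^ k := by
  induction k using Nat.strong_induction_on generalizing N with
  | _ k ih =>
  rcases k with _ | k
  · simp [const_one]
  rcases N with _ | N
  · simp only [zero_pow_succ, norm_zero]; positivity
  rw [succ_pow_succ, norm_mul, pow_succ']
  gcongr
  have hs : (N : ℝ) / (N + 1 : ℕ) * R + 1 / (N + 1 : ℕ) ≤ R := by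
    have h0 : (0 : ℝ) < (N + 1 : ℕ) := by positivity
    rw [div_mul_eq_mul_div, ← add_div, div_le_iff₀ h0]
    push_cast
    nlinarith
  calc _ ≤ ∑ j ∈ range (k + 1), ((N : ℝ) / (N + 1 : ℕ) * R) ^ j *
        (1 / ((N + 1 : ℕ) : ℝ)) ^ (k - j) * (k.choose j) := by
        refine (norm_sum_le _ _).trans (sum_le_sum fun j hj => ?_)
        have := ih j (mem_range.1 hj) N
        simp only [norm_mul, norm_pow, norm_div, Complex.norm_natCast, norm_one, mul_pow]
        calc _ ≤ ((N : ℝ) / (N + 1 : ℕ)) ^ j * (1 / ((N + 1 : ℕ) : ℝ)) ^ (k - j) *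
              (k.choose j) * R ^ j := by gcongr
          _ = _ := by ring
    _ = ((N : ℝ) / (N + 1 : ℕ) * R + 1 / (N + 1 : ℕ)) ^ k := (add_pow _ _ _).symm
    _ ≤ R ^ k := by gcongr

theorem tendsto_pow (x : ℂ) (k : ℕ) :
    Tendsto (fun N => bernsteinOp N x (fun z => z ^ k)) atTop (𝓝 (x ^ k)) := by
  induction k using Nat.strong_induction_on with
  | _ k ih =>
  rcases k with _ | k
  · simp only [pow_zero, const_one, tendsto_const_nhds]
  rw [← tendsto_add_atTop_iff_nat 1]
  simp only [succ_pow_succ]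
  have h1 : Tendsto (fun N : ℕ => 1 / ((N + 1 : ℕ) : ℂ)) atTop (𝓝 0) := by
    simpa using tendsto_one_div_add_atTop_nhds_zero_nat (𝕜 := ℂ)
  have h2 : Tendsto (fun N : ℕ => (N : ℂ) / (N + 1 : ℕ)) atTop (𝓝 1) := by
    simpa using tendsto_natCast_div_add_atTop (1 : ℂ)
  have h3 := tendsto_finsetSum (range (k + 1)) fun j hj =>
    (((h2.pow j).mul (h1.pow (k - j))).mul_const (k.choose j : ℂ)).mul (ih j (mem_range.1 hj))
  convert! h3.const_mul x using 2
  rw [pow_succ', sum_range_succ, sum_eq_zero]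
  · simp
  · intro j hj
    rw [zero_pow (Nat.sub_ne_zero_of_lt (mem_range.1 hj))]
    simp

/-- The error of the Bernstein operators at `x`, for functions bounded by `1` on the disc of
radius `2 * R`. -/
noncomputable def error (R : ℝ) (x : ℂ) (N : ℕ) : ℝ :=
  ∑' k : ℕ, (1 / (2 * R) ^ k) * ‖bernsteinOp N x (fun z => z ^ k) - x ^ k‖

theorem error_term_le {x : ℂ} {R : ℝ} (hR : 1 ≤ R) (hx : ‖x‖ ≤ R) (N k : ℕ) :
    (1 / (2 * R) ^ k) * ‖bernsteinOp N x (fun z => z ^ k) - x ^ k‖ ≤ 2 * (1 / 2) ^ k := by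
  have h : ‖bernsteinOp N x (fun z => z ^ k) - x ^ k‖ ≤ R ^ k + R ^ k := by
    refine (norm_sub_le _ _).trans (add_le_add (norm_pow_le hR hx k N) ?_)
    rw [norm_pow]
    gcongr
  calc _ ≤ (1 / (2 * R) ^ k) * (R ^ k + R ^ k) := by gcongr
    _ = _ := by
      have : R ^ k ≠ 0 := by positivity
      rw [mul_pow, one_div_pow]
      field_simp
      ring

theorem summable_two_mul_half_pow : Summable fun k : ℕ => (2 : ℝ) * (1 / 2) ^ k :=
  summable_geometric_two.mul_left 2

theorem tendsto_error {x : ℂ} {R : ℝ} (hR : 1 ≤ R) (hx : ‖x‖ ≤ R) :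
    Tendsto (error R x) atTop (𝓝 0) := by
  have h := tendsto_tsum_of_dominated_convergence (𝓕 := atTop)
    (f := fun N k => (1 / (2 * R) ^ k) * ‖bernsteinOp N x (fun z => z ^ k) - x ^ k‖)
    (g := fun _ : ℕ => (0 : ℝ)) summable_two_mul_half_pow
    (fun k => by
      have := ((tendsto_pow x k).sub_const (x ^ k)).norm.const_mul (1 / (2 * R) ^ k)
      simpa using this)
    (Eventually.of_forall fun N k => by
      rw [Real.norm_of_nonneg (by positivity)]
      exact error_term_le hR hx N k)
  rwa [tsum_zero] at h

section Entire

variable {f : ℂ → ℂ} {x : ℂ} {R C : ℝ}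

theorem exists_hasSum (hf : Differentiable ℂ f) (hR : 1 ≤ R)
    (hC : ∀ z, ‖z‖ ≤ 2 * R → ‖f z‖ ≤ C) :
    ∃ a : ℕ → ℂ, (∀ k, ‖a k‖ ≤ C * (1 / (2 * R) ^ k)) ∧
      (∀ z, HasSum (fun k => a k * z ^ k) (f z)) ∧
      ∀ N x, HasSum (fun k => a k * bernsteinOp N x (fun z => z ^ k)) (bernsteinOp N x f) := by
  have hs (z : ℂ) : HasSum (fun k : ℕ => ((k.factorial : ℂ)⁻¹ * iteratedDeriv k f 0) * z ^ k)
      (f z) := by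
    refine (Complex.hasSum_taylorSeries_of_entire hf 0 z).congr_fun fun k => ?_
    simp only [sub_zero, smul_eq_mul]
    ring
  refine ⟨fun k => (k.factorial : ℂ)⁻¹ * iteratedDeriv k f 0, fun k => ?_, hs, fun N x => ?_⟩
  · have h := Complex.norm_iteratedDeriv_le_of_forall_mem_sphere_norm_le (c := 0) (R := 2 * R)
      (C := C) k (by positivity) hf.diffContOnCl fun z hz => hC z (by simpa using hz.le)
    rw [norm_mul, norm_inv, Complex.norm_natCast, inv_mul_le_iff₀ (by positivity)]
    exact h.trans_eq (by ring)
  · have h := hasSum_sum (s := range (N + 1)) fun ν _ =>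
      (hs ((ν : ℂ) / N)).mul_left ((N.choose ν : ℂ) * x ^ ν * (1 - x) ^ (N - ν))
    refine h.congr_fun fun k => ?_
    rw [bernsteinOp, mul_sum]
    exact sum_congr rfl fun ν _ => by ring

theorem norm_sub_le (hf : Differentiable ℂ f) (hR : 1 ≤ R) (hx : ‖x‖ ≤ R)
    (hC : ∀ z, ‖z‖ ≤ 2 * R → ‖f z‖ ≤ C) (N : ℕ) :
    ‖bernsteinOp N x f - f x‖ ≤ C * error R x N := by
  obtain ⟨a, ha, hs, hB⟩ := exists_hasSum hf hR hC
  have hsum : Summable fun k : ℕ =>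
      (1 / (2 * R) ^ k) * ‖bernsteinOp N x (fun z => z ^ k) - x ^ k‖ :=
    summable_two_mul_half_pow.of_nonneg_of_le (fun k => by positivity)
      (error_term_le hR hx N)
  refine ((hB N x).sub (hs x)).norm_le_of_bounded (hsum.hasSum.mul_left C) fun k => ?_
  rw [← mul_sub, norm_mul, ← mul_assoc]
  gcongr
  exact ha k

theorem norm_le (hf : Differentiable ℂ f) (hR : 1 ≤ R) (hx : ‖x‖ ≤ R)
    (hC : ∀ z, ‖z‖ ≤ 2 * R → ‖f z‖ ≤ C) (N : ℕ) :
    ‖bernsteinOp N x f‖ ≤ 2 * C := by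
  obtain ⟨a, ha, -, hB⟩ := exists_hasSum hf hR hC
  rw [mul_comm]
  refine (hB N x).norm_le_of_bounded (hasSum_geometric_two.mul_left C) fun k => ?_
  have hC0 : 0 ≤ C := (norm_nonneg _).trans (hC 0 (by simpa using by positivity))
  calc _ ≤ C * (1 / (2 * R) ^ k) * R ^ k := by
        rw [norm_mul]
        exact mul_le_mul (ha k) (norm_pow_le hR hx k N) (norm_nonneg _) (by positivity)
    _ = _ := by
      have : R ^ k ≠ 0 := by positivity
      rw [mul_pow, one_div_pow]
      field_simp

end Entire

/-- Error bound for the tensor product of three Bernstein operators, applied to a function which is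
entire in each variable. -/
theorem norm_sub_le₃ {f : ℂ → ℂ → ℂ → ℂ} {x₁ x₂ x₃ : ℂ} {R C : ℝ}
    (h₁ : ∀ b c, Differentiable ℂ fun a => f a b c)
    (h₂ : ∀ a c, Differentiable ℂ fun b => f a b c)
    (h₃ : ∀ a b, Differentiable ℂ fun c => f a b c)
    (hR : 1 ≤ R) (hx₁ : ‖x₁‖ ≤ R) (hx₂ : ‖x₂‖ ≤ R) (hx₃ : ‖x₃‖ ≤ R)
    (hC : ∀ a b c, ‖a‖ ≤ 2 * R → ‖b‖ ≤ 2 * R → ‖c‖ ≤ 2 * R → ‖f a b c‖ ≤ C) (N₁ N₂ N₃ : ℕ) :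
    ‖bernsteinOp N₁ x₁ (fun a => bernsteinOp N₂ x₂ fun b => bernsteinOp N₃ x₃ fun c => f a b c) -
        f x₁ x₂ x₃‖ ≤
      C * (error R x₁ N₁ + 2 * error R x₂ N₂ + 4 * error R x₃ N₃) := by
  have le_two {y : ℂ} (hy : ‖y‖ ≤ R) : ‖y‖ ≤ 2 * R := by linarith
  have e₁ : ‖bernsteinOp N₁ x₁ (fun a => f a x₂ x₃) - f x₁ x₂ x₃‖ ≤ C * error R x₁ N₁ :=
    norm_sub_le (h₁ x₂ x₃) hR hx₁ (fun a ha => hC a _ _ ha (le_two hx₂) (le_two hx₃)) N₁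
  have e₂ : ‖bernsteinOp N₁ x₁ (fun a => bernsteinOp N₂ x₂ (fun b => f a b x₃) - f a x₂ x₃)‖ ≤
      2 * (C * error R x₂ N₂) :=
    norm_le ((differentiable N₂ x₂ fun b => h₁ b x₃).sub (h₁ x₂ x₃)) hR hx₁
      (fun a ha => norm_sub_le (h₂ a x₃) hR hx₂ (fun b hb => hC a b _ ha hb (le_two hx₃)) N₂) N₁
  have e₃ : ‖bernsteinOp N₁ x₁ (fun a => bernsteinOp N₂ x₂ fun b =>
      bernsteinOp N₃ x₃ (fun c => f a b c) - f a b x₃)‖ ≤ 2 * (2 * (C * error R x₃ N₃)) :=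
    norm_le (differentiable N₂ x₂ fun b =>
        (differentiable N₃ x₃ fun c => h₁ b c).sub (h₁ b x₃)) hR hx₁
      (fun a ha => norm_le ((differentiable N₃ x₃ fun c => h₂ a c).sub (h₂ a x₃)) hR hx₂
        (fun b hb => norm_sub_le (h₃ a b) hR hx₃ (fun c hc => hC a b c ha hb hc) N₃) N₂) N₁
  simp only [apply_sub] at e₂ e₃
  refine (congrArg norm ?_).trans_le ((norm_add₃_le).trans
    ((add_le_add (add_le_add e₁ e₂) e₃).trans_eq (by ring)))
  ring

end bernsteinOp

/-- The integrand (without `Φ`) of the evolution `ψ_{τ,α,ω}` at `(t, x)`, with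
`(τ, α, ω) = (1 - 2a, 1 - 2b, 1 - 2c)` continued to complex parameters. -/
noncomputable def evolutionKernel (t x ξ : ℝ) (a b c : ℂ) : ℂ :=
  Complex.exp (Real.log 2 * (-(1 - 2 * b) / 2)) / (2 * (Real.pi : ℂ)) *
    Complex.exp (Complex.I *
      (-((1 - 2 * a) * (ξ * Complex.exp (-(Real.log 2 * (1 - 2 * b))))) +
        ((1 - 2 * c) + ξ * Complex.exp (-(Real.log 2 * (1 - 2 * b)))) * x -
        ((1 - 2 * c) + ξ * Complex.exp (-(Real.log 2 * (1 - 2 * b)))) ^ 2 * t))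

namespace evolutionKernel

theorem differentiable_fst (t x ξ : ℝ) (b c : ℂ) :
    Differentiable ℂ fun a => evolutionKernel t x ξ a b c := by
  unfold evolutionKernel; fun_prop

theorem differentiable_snd (t x ξ : ℝ) (a c : ℂ) :
    Differentiable ℂ fun b => evolutionKernel t x ξ a b c := by
  unfold evolutionKernel
  simp only [div_eq_mul_inv]
  fun_prop

theorem differentiable_thd (t x ξ : ℝ) (a b : ℂ) :
    Differentiable ℂ fun c => evolutionKernel t x ξ a b c := by
  unfold evolutionKernel; fun_prop

theorem continuous_uncurried : Continuous fun q : (ℝ × ℝ) × ℝ × ℂ × ℂ × ℂ =>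
    evolutionKernel q.1.1 q.1.2 q.2.1 q.2.2.1 q.2.2.2.1 q.2.2.2.2 := by
  unfold evolutionKernel
  simp only [div_eq_mul_inv]
  fun_prop

theorem eq_of_real (τ α ω t x ξ : ℝ) {a b c : ℂ} (ha : 1 - 2 * a = τ) (hb : 1 - 2 * b = α)
    (hc : 1 - 2 * c = ω) :
    evolutionKernel t x ξ a b c =
      (((2 : ℝ) ^ (-α / 2) : ℝ) : ℂ) / (2 * (Real.pi : ℂ)) *
        Complex.exp (Complex.I *
          ((-(τ * ξ / (2 : ℝ) ^ α) + (ω + ξ / (2 : ℝ) ^ α) * x -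
            (ω + ξ / (2 : ℝ) ^ α) ^ 2 * t : ℝ) : ℂ)) := by
  have h : ((((2 : ℝ) ^ α : ℝ) : ℂ))⁻¹ = Complex.exp (-(Real.log 2 * α)) := by
    rw [Real.rpow_def_of_pos two_pos, Complex.exp_neg]
    push_cast
    rfl
  rw [evolutionKernel, ha, hb, hc, Real.rpow_def_of_pos two_pos (-α / 2)]
  simp only [Complex.ofReal_sub, Complex.ofReal_add, Complex.ofReal_neg, Complex.ofReal_mul,
    Complex.ofReal_pow, Complex.ofReal_div, Complex.ofReal_exp,
    div_eq_mul_inv _ (((2 : ℝ) ^ α : ℝ) : ℂ), h, mul_assoc, Complex.ofReal_ofNat]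

theorem integrable_mul {Φ : ℝ → ℂ} (hΦ : Integrable Φ) (hc : HasCompactSupport Φ) (t x : ℝ)
    (a b c : ℂ) : Integrable fun ξ => Φ ξ * evolutionKernel t x ξ a b c := by
  have hcont : Continuous fun ξ => evolutionKernel t x ξ a b c :=
    continuous_uncurried.comp (f := fun ξ : ℝ => ((t, x), ξ, a, b, c)) (by fun_prop)
  have h := hΦ.integrableOn.mul_continuousOn hcont.continuousOn hc.isCompact
  exact (integrableOn_iff_integrable_of_support_subset
    ((Function.support_mul_subset_left _ _).trans (subset_tsupport Φ))).1 h

end evolutionKernel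

/-- (Proposition 4.2) The Schrödinger evolution `ψ_{τ,α,ω}` of the translated, scaled
and modulated wavelet atom `x ↦ 2^{-α/2} Ψ((x-τ)/2^α) e^{iωx}` (with `Φ = Ψ̂`
integrable and compactly supported, as for Shannon's or Meyer's wavelet) is the
uniform limit, on every compact subset of `(0,∞) × ℝ`, of its three-variable
Bernstein sums in `(τ, α, ω)` as `min(N₁, N₂, N₃) → ∞`. -/
theorem statement_18 (Φ : ℝ → ℂ) (hΦint : Integrable Φ) (hΦsupp : HasCompactSupport Φ)
    (ψ : ℝ → ℝ → ℝ → ℝ → ℝ → ℂ)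
    (hψ : ∀ τ α ω t x : ℝ, 0 < t → ψ τ α ω t x =
      ((((2 : ℝ) ^ (-α / 2) : ℝ) : ℂ) / (2 * (Real.pi : ℂ))) *
        ∫ ξ : ℝ, Φ ξ * Complex.exp (Complex.I *
          ((-(τ * ξ / (2 : ℝ) ^ α) + (ω + ξ / (2 : ℝ) ^ α) * x -
            (ω + ξ / (2 : ℝ) ^ α) ^ 2 * t : ℝ) : ℂ)))
    (τ α ω : ℝ) (K : Set (ℝ × ℝ)) (hK : IsCompact K)
    (hKsub : K ⊆ Set.Ioi (0 : ℝ) ×ˢ Set.univ) :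
    ∀ ε > 0, ∃ M : ℕ, ∀ N₁ N₂ N₃ : ℕ, 1 ≤ N₁ → 1 ≤ N₂ → 1 ≤ N₃ →
      M ≤ N₁ → M ≤ N₂ → M ≤ N₃ → ∀ p ∈ K,
        ‖(∑ ν₁ ∈ Finset.range (N₁ + 1), ∑ ν₂ ∈ Finset.range (N₂ + 1),
            ∑ ν₃ ∈ Finset.range (N₃ + 1),
            (N₁.choose ν₁ : ℂ) * (N₂.choose ν₂ : ℂ) * (N₃.choose ν₃ : ℂ) *
              (((1 - τ) / 2 : ℝ) : ℂ) ^ ν₁ * (((1 + τ) / 2 : ℝ) : ℂ) ^ (N₁ - ν₁) *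
              (((1 - α) / 2 : ℝ) : ℂ) ^ ν₂ * (((1 + α) / 2 : ℝ) : ℂ) ^ (N₂ - ν₂) *
              (((1 - ω) / 2 : ℝ) : ℂ) ^ ν₃ * (((1 + ω) / 2 : ℝ) : ℂ) ^ (N₃ - ν₃) *
              ψ (1 - 2 * (ν₁ : ℝ) / (N₁ : ℝ)) (1 - 2 * (ν₂ : ℝ) / (N₂ : ℝ))
                (1 - 2 * (ν₃ : ℝ) / (N₃ : ℝ)) p.1 p.2) -
          ψ τ α ω p.1 p.2‖ < ε := by
  intro ε hε
  have hΦc : IsCompact (tsupport Φ) := hΦsupp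
  set x₁ : ℂ := (((1 - τ) / 2 : ℝ) : ℂ) with hx₁
  set x₂ : ℂ := (((1 - α) / 2 : ℝ) : ℂ) with hx₂
  set x₃ : ℂ := (((1 - ω) / 2 : ℝ) : ℂ) with hx₃
  set R : ℝ := 1 + ‖x₁‖ + ‖x₂‖ + ‖x₃‖ with hR
  have n₁ := norm_nonneg x₁
  have n₂ := norm_nonneg x₂
  have n₃ := norm_nonneg x₃
  have hR1 : 1 ≤ R := by linarith
  have b₁ : ‖x₁‖ ≤ R := by linarith
  have b₂ : ‖x₂‖ ≤ R := by linarith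
  have b₃ : ‖x₃‖ ≤ R := by linarith
  have hball := isCompact_closedBall (0 : ℂ) (2 * R)
  obtain ⟨C₀, hC₀⟩ := (hK.prod (hΦc.prod (hball.prod (hball.prod
    hball)))).exists_bound_of_continuousOn
    evolutionKernel.continuous_uncurried.continuousOn
  set C : ℝ := max C₀ 0
  set L : ℝ := ∫ ξ, ‖Φ ξ‖ with hL
  let η : ℝ := ε / (7 * (C * L + 1))
  have hL0 : 0 ≤ L := integral_nonneg fun ξ => norm_nonneg _
  have hC0 : 0 ≤ C := le_max_right _ _
  have hη : 0 < η := by positivity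
  have ev : ∀ᶠ N in atTop, bernsteinOp.error R x₁ N < η ∧ bernsteinOp.error R x₂ N < η ∧
      bernsteinOp.error R x₃ N < η :=
    ((bernsteinOp.tendsto_error hR1 b₁).eventually_lt_const hη).and
      (((bernsteinOp.tendsto_error hR1 b₂).eventually_lt_const hη).and
        ((bernsteinOp.tendsto_error hR1 b₃).eventually_lt_const hη))
  obtain ⟨M, hM⟩ := eventually_atTop.1 ev
  refine ⟨M, fun N₁ N₂ N₃ _ _ _ hN₁ hN₂ hN₃ p hp => ?_⟩
  have ht : 0 < p.1 := (hKsub hp).1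
  have hψ' (τ α ω : ℝ) (a b c : ℂ) (ha : 1 - 2 * a = τ) (hb : 1 - 2 * b = α)
      (hc : 1 - 2 * c = ω) :
      ψ τ α ω p.1 p.2 = ∫ ξ, Φ ξ * evolutionKernel p.1 p.2 ξ a b c := by
    rw [hψ _ _ _ _ _ ht, ← integral_const_mul]
    refine integral_congr_ae (Eventually.of_forall fun ξ => ?_)
    simp only [evolutionKernel.eq_of_real τ α ω p.1 p.2 ξ ha hb hc]
    ring
  let F : ℂ → ℂ → ℂ → ℝ → ℂ := fun a b c ξ => evolutionKernel p.1 p.2 ξ a b c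
  have i₀ (a b c : ℂ) : Integrable fun ξ => Φ ξ * F a b c ξ :=
    evolutionKernel.integrable_mul hΦint hΦsupp _ _ _ _ _
  have i₃ (a b : ℂ) := bernsteinOp.integral_mul N₃ x₃ (i₀ a b)
  have i₂ (a : ℂ) := bernsteinOp.integral_mul N₂ x₂ fun b => (i₃ a b).1
  have i₁ := bernsteinOp.integral_mul N₁ x₁ fun a => (i₂ a).1
  have hsum : (∑ ν₁ ∈ Finset.range (N₁ + 1), ∑ ν₂ ∈ Finset.range (N₂ + 1),
      ∑ ν₃ ∈ Finset.range (N₃ + 1),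
      (N₁.choose ν₁ : ℂ) * (N₂.choose ν₂ : ℂ) * (N₃.choose ν₃ : ℂ) *
        x₁ ^ ν₁ * (((1 + τ) / 2 : ℝ) : ℂ) ^ (N₁ - ν₁) *
        x₂ ^ ν₂ * (((1 + α) / 2 : ℝ) : ℂ) ^ (N₂ - ν₂) *
        x₃ ^ ν₃ * (((1 + ω) / 2 : ℝ) : ℂ) ^ (N₃ - ν₃) *
        ψ (1 - 2 * (ν₁ : ℝ) / (N₁ : ℝ)) (1 - 2 * (ν₂ : ℝ) / (N₂ : ℝ))
          (1 - 2 * (ν₃ : ℝ) / (N₃ : ℝ)) p.1 p.2) =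
      ∫ ξ, Φ ξ * bernsteinOp N₁ x₁ fun a => bernsteinOp N₂ x₂ fun b =>
        bernsteinOp N₃ x₃ fun c => F a b c ξ := by
    rw [i₁.2]
    simp only [(i₂ _).2, (i₃ _ _).2]
    have c₁ : (((1 + τ) / 2 : ℝ) : ℂ) = 1 - x₁ := by rw [hx₁]; push_cast; ring
    have c₂ : (((1 + α) / 2 : ℝ) : ℂ) = 1 - x₂ := by rw [hx₂]; push_cast; ring
    have c₃ : (((1 + ω) / 2 : ℝ) : ℂ) = 1 - x₃ := by rw [hx₃]; push_cast; ring
    simp only [c₁, c₂, c₃, bernsteinOp, mul_sum]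
    refine sum_congr rfl fun ν₁ _ => sum_congr rfl fun ν₂ _ => sum_congr rfl fun ν₃ _ => ?_
    rw [hψ' _ _ _ ((ν₁ : ℂ) / N₁) ((ν₂ : ℂ) / N₂) ((ν₃ : ℂ) / N₃) (by push_cast; ring)
      (by push_cast; ring) (by push_cast; ring)]
    ring
  rw [hsum, hψ' τ α ω x₁ x₂ x₃ (by rw [hx₁]; push_cast; ring) (by rw [hx₂]; push_cast; ring)
    (by rw [hx₃]; push_cast; ring), ← integral_sub i₁.1 (i₀ _ _ _)]
  obtain ⟨l₁, -, -⟩ := hM N₁ hN₁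
  obtain ⟨-, l₂, -⟩ := hM N₂ hN₂
  obtain ⟨-, -, l₃⟩ := hM N₃ hN₃
  have hbound : ∀ ξ, ‖Φ ξ * (bernsteinOp N₁ x₁ fun a => bernsteinOp N₂ x₂ fun b =>
        bernsteinOp N₃ x₃ fun c => F a b c ξ) - Φ ξ * F x₁ x₂ x₃ ξ‖ ≤ ‖Φ ξ‖ * (C * (7 * η)) := by
    intro ξ
    rw [← mul_sub, norm_mul]
    by_cases hξ : ξ ∈ tsupport Φ
    · gcongr
      refine (bernsteinOp.norm_sub_le₃ (f := fun a b c => F a b c ξ) (C := C)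
        (evolutionKernel.differentiable_fst _ _ _)
        (evolutionKernel.differentiable_snd _ _ _) (evolutionKernel.differentiable_thd _ _ _)
        hR1 b₁ b₂ b₃ (fun a b c ha hb hc => ?_) N₁ N₂ N₃).trans ?_
      · exact (hC₀ (p, ξ, a, b, c) ⟨hp, hξ, by simpa using ha, by simpa using hb,
          by simpa using hc⟩).trans (le_max_left _ _)
      · gcongr
        linarith
    · simp [image_eq_zero_of_notMem_tsupport hξ]
  refine (norm_integral_le_of_norm_le (hΦint.norm.mul_const _)
    (Eventually.of_forall hbound)).trans_lt ?_
  rw [integral_mul_const, ← hL]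
  calc L * (C * (7 * η)) = ε * ((C * L) / (C * L + 1)) := by
        simp only [η]; field_simp
    _ < ε * 1 := by
        gcongr
        rw [div_lt_one (by positivity)]
        linarith
    _ = ε := mul_one ε
end
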